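/- Let k be an algebraically closed field of characteristic 0, H a finite-dimensional semisimple Hopf algebra over k with antipode S and Haar integral Λ, and α : H → k an algebra map satisfying α(h_(1)) h_(2) = α(h_(2)) h_(1) for all h ∈ H; let L denote the 1-dimensional left H-module on which H acts through α. For a simple finite-dimensional left H-module V with character χ_V, set ν(V; L) := α(S(Λ_(1))) χ_V(Λ_(2) Λ_(3)) (Sweedler notation). Then ν(V; L) ∈ {0, +1, −1}, and the following are equivalent: (1) ν(V; L) ≠ 0; (2) V ≅ L ⊗ V^∨ as left H-modules; (3) there exists a nondegenerate bilinear form b : V × V → k with b(h_(1) v, h_(2) w) = α(h) b(v, w) for all h ∈ H and v, w ∈ V. Moreover, if these hold, such a bilinear form b is unique up to scalar multiples and satisfies b(w, v) = ν(V; L) · b(v, w) for all v, w ∈ V. -/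

import Mathlib

open TensorProduct

variable {k : Type*} [Field k]
variable {H : Type*} [Ring H] [HopfAlgebra k H]
variable {V : Type*} [AddCommGroup V] [Module k V]

/-- The twisted Frobenius–Schur indicator
`ν(V; L) = α(S(Λ₍₁₎)) · χ_V(Λ₍₂₎ Λ₍₃₎)` (Sweedler notation). -/
noncomputable def nuL (α : H →ₐ[k] k) (ρ : H →ₐ[k] Module.End k V) (Λ : H) : k :=
  LinearMap.mul' k k
    ((TensorProduct.map
        (α.toLinearMap ∘ₗ HopfAlgebra.antipode (R := k))
        ((LinearMap.trace k V ∘ₗ ρ.toLinearMap) ∘ₗ LinearMap.mul' k H))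
      ((TensorProduct.map LinearMap.id (Coalgebra.comul (R := k)))
        (Coalgebra.comul (R := k) Λ)))

/-- For a fixed `f ∈ V^∨`, the linear map `h ↦ f ∘ ρ(S(h))`, encoding the
`H`-action on the dual module `V^∨`: `⟨h·f, v⟩ = ⟨f, S(h)v⟩`. -/
noncomputable def dualActAux (ρ : H →ₐ[k] Module.End k V) (f : Module.Dual k V) :
    H →ₗ[k] Module.Dual k V :=
  (LinearMap.llcomp k V V k f) ∘ₗ ρ.toLinearMap ∘ₗ HopfAlgebra.antipode (R := k)

/-- The action of `h ∈ H` on `L ⊗ V^∨` (with `L` identified with `k` via the algebra map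
`α`): `h · f = α(h₍₁₎) • (f ∘ ρ(S(h₍₂₎)))` (Sweedler notation). -/
noncomputable def twistedDualAct (α : H →ₐ[k] k) (ρ : H →ₐ[k] Module.End k V)
    (h : H) (f : Module.Dual k V) : Module.Dual k V :=
  TensorProduct.lid k (Module.Dual k V)
    ((TensorProduct.map α.toLinearMap (dualActAux ρ f)) (Coalgebra.comul (R := k) h))

/-- A bilinear form `b` on `V` is `α`-invariant if `b(h₍₁₎v, h₍₂₎w) = α(h)·b(v, w)`
for all `h ∈ H` and `v, w ∈ V` (Sweedler notation). -/
def IsAlphaInvariantBil (α : H →ₐ[k] k) (ρ : H →ₐ[k] Module.End k V)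
    (b : V →ₗ[k] V →ₗ[k] k) : Prop :=
  ∀ (h : H) (v w : V),
    TensorProduct.lift b
        ((TensorProduct.homTensorHomMap (.id k) V V V V
            ((TensorProduct.map ρ.toLinearMap ρ.toLinearMap) (Coalgebra.comul (R := k) h)))
          (v ⊗ₜ[k] w)) =
      α h * b v w

/-- A bilinear form `b` on `V` is nondegenerate. -/
def IsNondegBil (b : V →ₗ[k] V →ₗ[k] k) : Prop :=
  (∀ v : V, (∀ w : V, b v w = 0) → v = 0) ∧ (∀ w : V, (∀ v : V, b v w = 0) → w = 0)

/-! ### Traces of operators of finite order -/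

section FiniteOrder

theorem Module.End.exists_trace_pow_eq [IsAlgClosed k] [CharZero k]
    {V : Type*} [AddCommGroup V] [Module k V] [FiniteDimensional k V]
    {f : Module.End k V} {m : ℕ} (hm : 0 < m) (hf : f ^ m = 1) :
    ∃ (s : Finset k) (n : k → ℕ), (∀ μ ∈ s, μ ^ m = 1) ∧
      ∀ j : ℕ, LinearMap.trace k V (f ^ j) = ∑ μ ∈ s, n μ * μ ^ j := by
  classical
  have hss : f.IsFinitelySemisimple := by
    refine (Module.End.isSemisimple_of_squarefree_aeval_eq_zero
      (p := (Polynomial.X ^ m - 1 : Polynomial k)) ?_ ?_).isFinitelySemisimple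
    · exact (Polynomial.X_pow_sub_one_separable_iff.2 (by exact_mod_cast hm.ne')).squarefree
    · simp [hf]
  have htop : ⨆ μ, f.eigenspace μ = ⊤ := by
    simp_rw [← hss.maxGenEigenspace_eq_eigenspace]
    exact f.iSup_maxGenEigenspace_eq_top
  have hds := DirectSum.isInternal_submodule_of_iSupIndep_of_iSup_eq_top
    f.eigenspaces_iSupIndep htop
  have hfin : {μ | f.eigenspace μ ≠ ⊥}.Finite :=
    WellFoundedGT.finite_ne_bot_of_iSupIndep f.eigenspaces_iSupIndep
  have hpow (μ : k) (j : ℕ) {v : V} (hv : v ∈ f.eigenspace μ) : (f ^ j) v = μ ^ j • v := by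
    induction j with
    | zero => simp
    | succ j ih => rw [pow_succ', Module.End.mul_apply, ih, map_smul,
        Module.End.mem_eigenspace_iff.1 hv, smul_smul, pow_succ]
  refine ⟨hfin.toFinset, fun μ => Module.finrank k (f.eigenspace μ), ?_, fun j => ?_⟩
  · intro μ hμ
    rw [Set.Finite.mem_toFinset, Set.mem_ofPred_eq, Submodule.ne_bot_iff] at hμ
    obtain ⟨v, hv, hv0⟩ := hμ
    have h := hpow μ m hv
    rw [hf, Module.End.one_apply] at h
    by_contra hne
    exact hv0 (((smul_eq_zero (r := μ ^ m - 1)).1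
      (by rw [sub_smul, one_smul, ← h, sub_self])).resolve_left (sub_ne_zero.2 hne))
  · have hmaps (μ : k) : Set.MapsTo (f ^ j) (f.eigenspace μ) (f.eigenspace μ) := by
      intro v hv
      rw [hpow μ j hv]
      exact Submodule.smul_mem _ _ hv
    rw [LinearMap.trace_eq_sum_trace_restrict' hds hfin hmaps]
    refine Finset.sum_congr rfl fun μ _ => ?_
    have : (f ^ j).restrict (hmaps μ) = μ ^ j • LinearMap.id := by
      ext v
      exact hpow μ j v.2
    rw [this, map_smul, LinearMap.trace_id, smul_eq_mul, mul_comm]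

/-- An integral combination of roots of unity, together with the combination of the inverse roots,
lies in the algebraic closure of `ℚ`, where any complex embedding exchanges the two by complex
conjugation. -/
theorem exists_algebraic_conj_sum [CharZero k]
    (φ : algebraicClosure ℚ k →+* ℂ) {m : ℕ} (hm : 0 < m) (s : Finset k) (n : k → ℕ)
    (hs : ∀ μ ∈ s, μ ^ m = 1) :
    ∃ z w : algebraicClosure ℚ k, (z : k) = ∑ μ ∈ s, n μ * μ ∧
      (w : k) = ∑ μ ∈ s, n μ * μ ^ (m - 1) ∧ φ w = starRingEnd ℂ (φ z) := by
  classical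
  induction s using Finset.induction_on with
  | empty => exact ⟨0, 0, by simp⟩
  | insert μ s hμ ih =>
    obtain ⟨z, w, hz, hw, hzw⟩ := ih fun ν hν => hs ν (Finset.mem_insert_of_mem hν)
    have h1 := hs μ (Finset.mem_insert_self _ _)
    have halg : μ ∈ algebraicClosure ℚ k := by
      rw [mem_algebraicClosure_iff]
      exact (IsIntegral.of_pow hm (by rw [h1]; exact isIntegral_one)).isAlgebraic
    let u : algebraicClosure ℚ k := ⟨μ, halg⟩
    have hu : u ^ m = 1 := Subtype.ext h1
    have hφ : φ (u ^ (m - 1)) = starRingEnd ℂ (φ u) := by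
      have hp : φ u ^ m = 1 := by rw [← map_pow, hu, map_one]
      have hn : ‖φ u‖ = 1 := Complex.norm_eq_one_of_pow_eq_one hp hm.ne'
      have h0 : φ u ≠ 0 := by
        rw [← norm_ne_zero_iff, hn]
        exact one_ne_zero
      refine mul_right_cancel₀ h0 ?_
      rw [map_pow, ← pow_succ, Nat.sub_add_cancel hm, hp, mul_comm, Complex.mul_conj,
        Complex.normSq_eq_norm_sq, hn]
      simp
    refine ⟨n μ * u + z, n μ * u ^ (m - 1) + w, ?_, ?_, ?_⟩
    · simp [Finset.sum_insert hμ, hz, u]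
    · simp [Finset.sum_insert hμ, hw, u]
    · rw [map_add, map_mul, hφ, hzw]
      simp

theorem algebraicClosure.nonempty_ringHom (F K C : Type*) [Field F] [Field K] [Field C]
    [IsAlgClosed C] [Algebra F K] [Algebra F C] : Nonempty (algebraicClosure F K →+* C) :=
  ⟨(IsAlgClosed.lift (R := F)).toRingHom⟩

theorem Matrix.trace_pow_eq_zero_of_sum_trace_mul_trace_eq_zero [IsAlgClosed k] [CharZero k]
    {ι : Type*} [Fintype ι] {d : ι → ℕ} {B : ∀ i, Matrix (Fin (d i)) (Fin (d i)) k}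
    {m : ℕ} (hm : 0 < m) (hB : ∀ i, B i ^ m = 1)
    (h0 : ∑ i, (B i).trace * (B i ^ (m - 1)).trace = 0) (i : ι) : (B i ^ (m - 1)).trace = 0 := by
  obtain ⟨φ⟩ := algebraicClosure.nonempty_ringHom ℚ k ℂ
  have key (i : ι) : ∃ z w : algebraicClosure ℚ k, (z : k) = (B i).trace ∧
      (w : k) = (B i ^ (m - 1)).trace ∧ φ w = starRingEnd ℂ (φ z) := by
    have hf : (Matrix.toLin' (B i)) ^ m = 1 := by
      rw [← Matrix.toLin'_pow, hB, Matrix.toLin'_one]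
      rfl
    obtain ⟨s, n, hs, ht⟩ := Module.End.exists_trace_pow_eq hm hf
    obtain ⟨z, w, hz, hw, hzw⟩ := exists_algebraic_conj_sum φ hm s n hs
    refine ⟨z, w, ?_, ?_, hzw⟩
    · rw [hz, ← Matrix.trace_toLin'_eq]
      simpa using (ht 1).symm
    · rw [hw, ← Matrix.trace_toLin'_eq, Matrix.toLin'_pow, ht]
  choose z w hz hw hzw using key
  have h1 : ∑ i, z i * w i = 0 := by
    apply Subtype.ext
    push_cast
    simpa [hz, hw] using h0
  have h2 : ∑ i, ‖φ (z i)‖ ^ 2 = 0 := by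
    have h3 := congrArg φ h1
    simp only [map_sum, map_mul, hzw, Complex.mul_conj, map_zero,
      Complex.normSq_eq_norm_sq] at h3
    exact_mod_cast h3
  have h4 := (Finset.sum_eq_zero_iff_of_nonneg fun i _ => by positivity).1 h2 i (Finset.mem_univ i)
  have h5 : φ (w i) = 0 := by
    rw [hzw, map_eq_zero, ← norm_eq_zero]
    exact pow_eq_zero_iff two_ne_zero |>.1 h4
  rw [← hw, (map_eq_zero φ).1 h5]
  rfl

theorem Matrix.trace_eq_zero_of_sum_trace_mul_trace_eq_zero [IsAlgClosed k] [CharZero k]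
    {ι : Type*} [Fintype ι] {d : ι → ℕ} {A A' : ∀ i, Matrix (Fin (d i)) (Fin (d i)) k}
    (hA : ∀ i, A i * A' i = 1) {m : ℕ} (hm : 0 < m) {c : ι → k} (hc : ∀ i, c i ≠ 0)
    (hAc : ∀ i, A i ^ m = c i • (1 : Matrix _ _ k))
    (h0 : ∑ i, (A i).trace * (A' i).trace = 0) (i : ι) : (A' i).trace = 0 := by
  have hr (i : ι) : ∃ r : k, r ^ m = c i := IsAlgClosed.exists_pow_nat_eq _ hm
  choose r hr using hr
  have hr0 (i : ι) : r i ≠ 0 := by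
    intro h
    exact hc i (by rw [← hr, h, zero_pow hm.ne'])
  let B : ∀ i, Matrix (Fin (d i)) (Fin (d i)) k := fun i => (r i)⁻¹ • A i
  have hB (i : ι) : B i ^ m = 1 := by
    simp only [B, smul_pow, hAc, smul_smul, inv_pow, hr]
    rw [inv_mul_cancel₀ (hc i), one_smul]
  have hB' (i : ι) : B i ^ (m - 1) = r i • A' i := by
    have h1 : B i * (r i • A' i) = 1 := by
      simp [B, hA, smul_smul, hr0]
    rw [← mul_one (B i ^ (m - 1)), ← h1, ← mul_assoc, ← pow_succ, Nat.sub_add_cancel hm, hB,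
      one_mul]
  have h1 := Matrix.trace_pow_eq_zero_of_sum_trace_mul_trace_eq_zero hm hB (by
    rw [← h0]
    refine Finset.sum_congr rfl fun i _ => ?_
    rw [hB', Matrix.trace_smul, Matrix.trace_smul, smul_eq_mul, smul_eq_mul]
    field_simp [hr0 i]) i
  rw [hB', Matrix.trace_smul, smul_eq_mul] at h1
  exact (mul_eq_zero.1 h1).resolve_left (hr0 i)

end FiniteOrder

/-! ### Traces of inner automorphisms of semisimple algebras -/

section BlockTrace

variable {ι : Type*} [Fintype ι] {d : ι → ℕ}

variable (k d) in
/-- The sum of the traces of the blocks of an element of a product of matrix algebras. -/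
def blockTrace : (Π i, Matrix (Fin (d i)) (Fin (d i)) k) →ₗ[k] k :=
  ∑ i, Matrix.traceLinearMap (Fin (d i)) k k ∘ₗ LinearMap.proj i

theorem blockTrace_apply (x : Π i, Matrix (Fin (d i)) (Fin (d i)) k) :
    blockTrace k d x = ∑ i, (x i).trace := by
  simp [blockTrace]

theorem blockTrace_mul_comm (x y : Π i, Matrix (Fin (d i)) (Fin (d i)) k) :
    blockTrace k d (x * y) = blockTrace k d (y * x) := by
  simp_rw [blockTrace_apply, Pi.mul_apply]
  exact Finset.sum_congr rfl fun i _ => Matrix.trace_mul_comm _ _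

theorem eq_zero_of_blockTrace_mul {x : Π i, Matrix (Fin (d i)) (Fin (d i)) k}
    (hx : ∀ y, blockTrace k d (x * y) = 0) : x = 0 := by
  classical
  funext i
  refine Matrix.ext_iff_trace_mul_right.2 fun Y => ?_
  have h := hx (Pi.single i Y)
  rw [blockTrace_apply, Finset.sum_eq_single i] at h
  · simpa using h
  · intro j _ hj
    simp [hj]
  · simp

theorem exists_blockTrace_mul (ξ : (Π i, Matrix (Fin (d i)) (Fin (d i)) k) →ₗ[k] k) :
    ∃ A, ∀ x, ξ x = blockTrace k d (A * x) := by
  let P := Π i, Matrix (Fin (d i)) (Fin (d i)) k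
  let F : P →ₗ[k] Module.Dual k P := (LinearMap.mul k P).compr₂ (blockTrace k d)
  have hF : Function.Injective F := by
    rw [injective_iff_map_eq_zero]
    exact fun x hx => eq_zero_of_blockTrace_mul fun y => LinearMap.congr_fun hx y
  have hs : Function.Surjective F :=
    (LinearMap.injective_iff_surjective_of_finrank_eq_finrank Subspace.dual_finrank_eq.symm).1 hF
  obtain ⟨A, hA⟩ := hs ξ
  exact ⟨A, fun x => by rw [← hA]; rfl⟩

theorem trace_mulLeft_comp_mulRight (a b : Π i, Matrix (Fin (d i)) (Fin (d i)) k) :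
    LinearMap.trace k _ (LinearMap.mulLeft k a ∘ₗ LinearMap.mulRight k b) =
      ∑ i, (a i).trace * (b i).trace := by
  classical
  let B := Pi.basis fun i => Matrix.stdBasis k (Fin (d i)) (Fin (d i))
  rw [LinearMap.trace_eq_matrix_trace k B, Matrix.trace, Fintype.sum_sigma]
  refine Finset.sum_congr rfl fun i _ => ?_
  rw [Fintype.sum_prod_type, Matrix.trace, Matrix.trace, Finset.sum_mul_sum]
  refine Finset.sum_congr rfl fun p _ => Finset.sum_congr rfl fun q _ => ?_
  have hr (y : Π i, Matrix (Fin (d i)) (Fin (d i)) k) : B.repr y ⟨i, p, q⟩ = y i p q := by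
    rw [Pi.basis_repr]
    rfl
  rw [Matrix.diag_apply, LinearMap.toMatrix_apply, hr, Pi.basis_apply, Matrix.stdBasis_eq_single]
  simp [Matrix.mul_apply, Matrix.single_apply, ite_and]

theorem trace_ne_zero_of_pow_eq_one_of_pi_matrix [IsAlgClosed k] [CharZero k]
    (hd : ∀ i, NeZero (d i))
    {σ : Module.End k (Π i, Matrix (Fin (d i)) (Fin (d i)) k)}
    {ξ : (Π i, Matrix (Fin (d i)) (Fin (d i)) k) →ₗ[k] k}
    (hσ : ∀ x y, ξ (x * y) = ξ (y * σ x)) (hnd : ∀ x, (∀ y, ξ (x * y) = 0) → x = 0)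
    (hξ : ∀ x, ξ x = LinearMap.trace k _ (LinearMap.mulLeft k x ∘ₗ σ)) (h0 : ξ ≠ 0)
    {m : ℕ} (hm : 0 < m) (hσm : σ ^ m = 1) : LinearMap.trace k _ σ ≠ 0 := by
  classical
  obtain ⟨A, hA⟩ := exists_blockTrace_mul ξ
  have hAσ (x) : A * x = σ x * A := by
    rw [← sub_eq_zero]
    refine eq_zero_of_blockTrace_mul fun y => ?_
    rw [sub_mul, map_sub, sub_eq_zero, mul_assoc, ← hA, hσ, hA, ← mul_assoc,
      blockTrace_mul_comm, ← mul_assoc]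
  have hinj : Function.Injective (LinearMap.mulLeft k A) := by
    rw [injective_iff_map_eq_zero]
    refine fun x hx => hnd x fun y => ?_
    rw [hA, ← mul_assoc]
    rw [LinearMap.mulLeft_apply] at hx
    rw [hx, zero_mul, map_zero]
  obtain ⟨A', hA'⟩ := LinearMap.injective_iff_surjective.1 hinj 1
  have hAA' (i : ι) : A i * A' i = 1 := congrFun hA' i
  have hσ' (x) : σ x = A * x * A' := by
    rw [hAσ, mul_assoc]
    exact (by rw [show A * A' = 1 from hA', mul_one])
  have htr (x) : LinearMap.trace k _ (LinearMap.mulLeft k x ∘ₗ σ) =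
      ∑ i, (x i * A i).trace * (A' i).trace := by
    refine Eq.trans ?_ (trace_mulLeft_comp_mulRight (x * A) A')
    congr 1
    refine LinearMap.ext fun y => ?_
    simp [hσ', mul_assoc]
  intro ht
  have ht' : ∑ i, (A i).trace * (A' i).trace = 0 := by
    have h1 := htr 1
    rw [LinearMap.mulLeft_one, LinearMap.id_comp, ht] at h1
    simpa using h1.symm
  have hpow (j : ℕ) (x) : A ^ j * x = (σ ^ j) x * A ^ j := by
    induction j generalizing x with
    | zero => simp
    | succ j ih =>
      rw [pow_succ, mul_assoc, hAσ, ← mul_assoc, ih, pow_succ, mul_assoc]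
      rfl
  have hscalar (i : ι) : ∃ c : k, A i ^ m = c • (1 : Matrix (Fin (d i)) (Fin (d i)) k) := by
    have h1 : A i ^ m ∈ Set.range (Matrix.scalar (Fin (d i))) := by
      refine Matrix.mem_range_scalar_of_commute_single fun p q _ => ?_
      have h2 := congrFun (hpow m (Pi.single i (Matrix.single p q 1))) i
      rw [hσm] at h2
      exact (by simpa using h2.symm : Matrix.single p q 1 * A i ^ m = _)
    obtain ⟨c, hc⟩ := h1
    exact ⟨c, by rw [← hc, Matrix.smul_one_eq_diagonal]; rfl⟩
  choose c hc using hscalar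
  have hc0 (i : ι) : c i ≠ 0 := by
    intro h
    have h1 : IsUnit (A i) := IsUnit.of_mul_eq_one _ (hAA' i)
    have h2 := h1.pow m
    rw [hc, h, zero_smul] at h2
    exact not_isUnit_zero h2
  have hz := Matrix.trace_eq_zero_of_sum_trace_mul_trace_eq_zero hAA' hm hc0 hc ht'
  exact h0 (LinearMap.ext fun x => by simp [hξ, htr, hz])

end BlockTrace

theorem IsSemisimpleRing.trace_ne_zero_of_pow_eq_one {k : Type*} [Field k] [IsAlgClosed k]
    [CharZero k] {R : Type*} [Ring R] [Algebra k R] [FiniteDimensional k R] [IsSemisimpleRing R]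
    {σ : Module.End k R} {ξ : R →ₗ[k] k}
    (hσ : ∀ x y, ξ (x * y) = ξ (y * σ x)) (hnd : ∀ x, (∀ y, ξ (x * y) = 0) → x = 0)
    (hξ : ∀ x, ξ x = LinearMap.trace k R (LinearMap.mulLeft k x ∘ₗ σ)) (h0 : ξ ≠ 0)
    {m : ℕ} (hm : 0 < m) (hσm : σ ^ m = 1) : LinearMap.trace k R σ ≠ 0 := by
  obtain ⟨n, d, hd, ⟨e⟩⟩ := IsSemisimpleRing.exists_algEquiv_pi_matrix_of_isAlgClosed k R
  have key := trace_ne_zero_of_pow_eq_one_of_pi_matrix (k := k) hd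
    (σ := e.toLinearEquiv.conj σ) (ξ := ξ ∘ₗ e.symm.toLinearMap) ?_ ?_ ?_ ?_ hm ?_
  · rwa [LinearMap.trace_conj'] at key
  · intro x y
    simp [LinearEquiv.conj_apply, hσ (e.symm x)]
  · intro x hx
    rw [← e.symm.map_eq_zero_iff]
    refine hnd _ fun y => ?_
    simpa using hx (e y)
  · intro x
    rw [LinearMap.comp_apply, hξ, ← LinearMap.trace_conj' _ e.toLinearEquiv]
    congr 1
    refine LinearMap.ext fun y => ?_
    simp [LinearEquiv.conj_apply]
  · intro h
    refine h0 (LinearMap.ext fun x => ?_)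
    simpa using LinearMap.congr_fun h (e x)
  · have h := map_pow (e.toLinearEquiv.conjAlgEquiv k) σ m
    rw [hσm, map_one] at h
    exact h.symm

theorem LinearMap.exists_trace_eq_natCast {k : Type*} [Field k] {V : Type*} [AddCommGroup V]
    [Module k V] [FiniteDimensional k V] {e : Module.End k V} (he : IsIdempotentElem e) :
    ∃ r : ℕ, LinearMap.trace k V e = r :=
  ⟨_, (LinearMap.IsIdempotentElem.isProj_range e he).trace⟩

/-- An involution `σ` with a nonzero fixed vector is trivial as soon as its trace is a nonzero
integral multiple of the dimension. -/
theorem Module.End.eq_one_of_involutive {k : Type*} [Field k] [CharZero k] {V : Type*}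
    [AddCommGroup V] [Module k V] [FiniteDimensional k V] {σ E : Module.End k V}
    (hσ : σ * σ = 1) (hE : E * E = (Module.finrank k V : k) • E) (hc : Commute E σ)
    (ht : LinearMap.trace k V (E * σ) = LinearMap.trace k V σ)
    (h0 : LinearMap.trace k V σ ≠ 0) {v : V} (hv : v ≠ 0) (hσv : σ v = v) : σ = 1 := by
  have : Nontrivial V := ⟨v, 0, hv⟩
  have hn : (Module.finrank k V : k) ≠ 0 := by exact_mod_cast Module.finrank_pos.ne'
  set n := Module.finrank k V with hndef
  let F : Module.End k V := (n : k)⁻¹ • E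
  have hF : F * F = F := by
    simp only [F, smul_mul_smul_comm, hE, smul_smul]
    congr 1
    field_simp
  have hcF : Commute F σ := hc.smul_left _
  let e₁ : Module.End k V := (2 : k)⁻¹ • (1 + σ)
  let e₂ : Module.End k V := (2 : k)⁻¹ • (1 - σ)
  have he₁ : IsIdempotentElem e₁ := by
    have : (1 + σ) * (1 + σ) = (2 : k) • (1 + σ) := by
      rw [two_smul, mul_add, add_mul, add_mul, hσ]
      simp only [one_mul, mul_one]
      abel
    simp only [IsIdempotentElem, e₁, smul_mul_smul_comm, this, smul_smul]
    congr 1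
    field_simp
  have he₂ : IsIdempotentElem e₂ := by
    have : (1 - σ) * (1 - σ) = (2 : k) • (1 - σ) := by
      rw [two_smul, mul_sub, sub_mul, sub_mul, hσ]
      simp only [one_mul, mul_one]
      abel
    simp only [IsIdempotentElem, e₂, smul_mul_smul_comm, this, smul_smul]
    congr 1
    field_simp
  have hc₁ : Commute F e₁ := ((Commute.one_right F).add_right hcF).smul_right _
  have hc₂ : Commute F e₂ := ((Commute.one_right F).sub_right hcF).smul_right _
  have hF₁ : IsIdempotentElem (F * e₁) := IsIdempotentElem.mul_of_commute hc₁ hF he₁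
  have hF₂ : IsIdempotentElem (F * e₂) := IsIdempotentElem.mul_of_commute hc₂ hF he₂
  obtain ⟨r₁, hr₁⟩ := LinearMap.exists_trace_eq_natCast hF₁
  obtain ⟨r₂, hr₂⟩ := LinearMap.exists_trace_eq_natCast hF₂
  obtain ⟨n₁, hn₁⟩ := LinearMap.exists_trace_eq_natCast he₁
  obtain ⟨n₂, hn₂⟩ := LinearMap.exists_trace_eq_natCast he₂
  have hsub : e₁ - e₂ = σ := by
    simp only [e₁, e₂, ← smul_sub]
    rw [show (1 + σ) - (1 - σ) = (2 : k) • σ by rw [two_smul]; abel, smul_smul,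
      inv_mul_cancel₀ two_ne_zero, one_smul]
  have hadd : e₁ + e₂ = 1 := by
    simp only [e₁, e₂, ← smul_add]
    rw [show (1 + σ) + (1 - σ) = (2 : k) • 1 by rw [two_smul]; abel, smul_smul,
      inv_mul_cancel₀ two_ne_zero, one_smul]
  have hsum : n₁ + n₂ = n := by
    have h := congrArg (LinearMap.trace k V) hadd
    rw [map_add, hn₁, hn₂, LinearMap.trace_one] at h
    exact_mod_cast h
  have htσ : LinearMap.trace k V σ = n₁ - n₂ := by rw [← hsub, map_sub, hn₁, hn₂]
  have hr : (n₁ : k) - n₂ = n * (r₁ - r₂) := by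
    rw [← htσ, ← ht, ← hr₁, ← hr₂, ← map_sub, ← mul_sub, hsub]
    simp only [F, smul_mul_assoc, map_smul, smul_eq_mul]
    field_simp
  have hrz : (n₁ : ℤ) - n₂ = n * (r₁ - r₂) := by exact_mod_cast hr
  have hne : (n₁ : ℤ) - n₂ ≠ 0 := by
    intro h
    rw [htσ] at h0
    exact h0 (by exact_mod_cast h)
  have h1 : n₁ ≠ 0 := by
    rintro rfl
    have h := LinearMap.IsIdempotentElem.eq_zero_of_trace_eq_zero he₁ (by rw [hn₁, Nat.cast_zero])
    have h2 : e₁ v = v := by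
      simp only [e₁, LinearMap.smul_apply, LinearMap.add_apply, Module.End.one_apply, hσv]
      rw [← two_smul k v, smul_smul, inv_mul_cancel₀ two_ne_zero, one_smul]
    exact hv (by rw [← h2, h, LinearMap.zero_apply])
  have h2 : n₂ = 0 := by
    by_contra h2
    have hz : (r₁ : ℤ) - r₂ ≠ 0 := by
      intro h
      rw [h, mul_zero] at hrz
      exact hne hrz
    have hle : (n : ℤ) ≤ |(n₁ : ℤ) - n₂| := by
      rw [hrz, abs_mul, Nat.abs_cast]
      exact le_mul_of_one_le_right (Int.natCast_nonneg _) (Int.one_le_abs hz)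
    rw [le_abs] at hle
    omega
  have h3 := LinearMap.IsIdempotentElem.eq_zero_of_trace_eq_zero he₂
    (by rw [hn₂, h2, Nat.cast_zero])
  rw [← hsub, h3, sub_zero, ← hadd, h3, add_zero]

namespace HopfAlgebra

open Coalgebra WithConv

local notation "𝒮" => HopfAlgebra.antipode k (A := H)
local notation "ι₁" => AlgHom.toLinearMap (Algebra.TensorProduct.includeLeft (R := k) (S := k) (A := H) (B := H))
local notation "ι₂" => AlgHom.toLinearMap (Algebra.TensorProduct.includeRight (R := k) (A := H) (B := H))

section Integrals

/-- The comultiplication is the convolution product of the two inclusions `H → H ⊗ H`. -/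
theorem toConv_comul : toConv (comul (R := k) (A := H)) = toConv ι₁ * toConv ι₂ := by
  refine WithConv.ext (LinearMap.ext fun h => ?_)
  change comul (R := k) h = LinearMap.mul' k (H ⊗[k] H) (TensorProduct.map _ _ (comul h))
  generalize comul (R := k) h = t
  induction t with
  | zero => simp
  | add x y hx hy => rw [map_add, map_add, ← hx, ← hy]
  | tmul x y => simp

theorem toConv_algHom_mul_antipode {A : Type*} [Ring A] [Algebra k A] (f : H →ₐ[k] A) :
    toConv f.toLinearMap * toConv (f.toLinearMap ∘ₗ 𝒮) = 1 := by
  have h := LinearMap.algHom_comp_convMul_distrib f (toConv LinearMap.id) (toConv 𝒮)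
  rw [LinearMap.id_mul_antipode] at h
  refine WithConv.ext (h.symm.trans ?_)
  ext x
  simp [LinearMap.convOne_def]

theorem toConv_antipode_mul_algHom {A : Type*} [Ring A] [Algebra k A] (f : H →ₐ[k] A) :
    toConv (f.toLinearMap ∘ₗ 𝒮) * toConv f.toLinearMap = 1 := by
  have h := LinearMap.algHom_comp_convMul_distrib f (toConv 𝒮) (toConv LinearMap.id)
  rw [LinearMap.antipode_mul_id] at h
  refine WithConv.ext (h.symm.trans ?_)
  ext x
  simp [LinearMap.convOne_def]

/-- `x₍₁₎ ⊗ x₍₂₎ S(x₍₃₎) = x ⊗ 1`. -/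
theorem toConv_comul_mul_antipode :
    toConv (comul (R := k) (A := H)) * toConv (ι₂ ∘ₗ 𝒮) = toConv ι₁ := by
  rw [toConv_comul, mul_assoc, toConv_algHom_mul_antipode, mul_one]

/-- `S(x₍₁₎) x₍₂₎ ⊗ x₍₃₎ = 1 ⊗ x`. -/
theorem toConv_antipode_mul_comul :
    toConv (ι₁ ∘ₗ 𝒮) * toConv (comul (R := k) (A := H)) = toConv ι₂ := by
  rw [toConv_comul, ← mul_assoc, toConv_antipode_mul_algHom, one_mul]

theorem toConv_comul_comp_antipode :
    toConv (comul (R := k) (A := H) ∘ₗ 𝒮) = toConv (ι₂ ∘ₗ 𝒮) * toConv (ι₁ ∘ₗ 𝒮) := by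
  refine left_inv_eq_right_inv (a := toConv (comul (R := k) (A := H))) ?_ ?_
  · exact toConv_antipode_mul_algHom (Bialgebra.comulAlgHom k H)
  · rw [← mul_assoc, toConv_comul_mul_antipode, toConv_algHom_mul_antipode]

/-- The antipode is anti-comultiplicative. -/
theorem comul_antipode (h : H) :
    comul (R := k) (𝒮 h) =
      TensorProduct.map 𝒮 𝒮 (TensorProduct.comm k H H (comul (R := k) h)) := by
  have e := congrArg (fun f : WithConv (H →ₗ[k] H ⊗[k] H) => f h)
    (toConv_comul_comp_antipode (k := k) (H := H))
  refine e.trans ?_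
  rw [LinearMap.convMul_apply]
  generalize comul (R := k) h = t
  induction t with
  | zero => simp
  | add x y hx hy => simp only [map_add, hx, hy]
  | tmul x y => simp

theorem comul_antipode_antipode (h : H) :
    comul (R := k) (𝒮 (𝒮 h)) =
      TensorProduct.map (𝒮 ∘ₗ 𝒮) (𝒮 ∘ₗ 𝒮) (comul (R := k) h) := by
  rw [comul_antipode, comul_antipode]
  generalize comul (R := k) h = t
  induction t with
  | zero => simp
  | add x y hx hy => simp only [map_add, hx, hy]
  | tmul x y => simp

theorem antipode_antipode_mul (x y : H) : 𝒮 (𝒮 (x * y)) = 𝒮 (𝒮 x) * 𝒮 (𝒮 y) := by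
  rw [antipode_mul_antidistrib, antipode_mul_antidistrib]

/-! ### Left and right integrals on `H` -/

/-- `contractRight ξ (x ⊗ y) = ξ(y) x`. -/
noncomputable def contractRight (ξ : H →ₗ[k] k) : H ⊗[k] H →ₗ[k] H :=
  (TensorProduct.rid k H).toLinearMap ∘ₗ TensorProduct.map LinearMap.id ξ

/-- `contractLeft ξ (x ⊗ y) = ξ(x) y`. -/
noncomputable def contractLeft (ξ : H →ₗ[k] k) : H ⊗[k] H →ₗ[k] H :=
  (TensorProduct.lid k H).toLinearMap ∘ₗ TensorProduct.map ξ LinearMap.id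

@[simp] theorem contractRight_tmul (ξ : H →ₗ[k] k) (x y : H) :
    contractRight ξ (x ⊗ₜ[k] y) = ξ y • x := by simp [contractRight]

@[simp] theorem contractLeft_tmul (ξ : H →ₗ[k] k) (x y : H) :
    contractLeft ξ (x ⊗ₜ[k] y) = ξ x • y := by simp [contractLeft]

/-- `h₍₁₎ ξ(h₍₂₎) = ξ(h) 1`. -/
def IsLeftIntegral (ξ : H →ₗ[k] k) : Prop :=
  ∀ h, contractRight ξ (comul (R := k) h) = ξ h • (1 : H)

/-- `ξ(h₍₁₎) h₍₂₎ = ξ(h) 1`. -/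
def IsRightIntegral (ξ : H →ₗ[k] k) : Prop :=
  ∀ h, contractLeft ξ (comul (R := k) h) = ξ h • (1 : H)

theorem comul_mul_tmul_one {Λ : H} (hΛ : ∀ h : H, Λ * h = counit (R := k) h • Λ) (x : H) :
    comul (R := k) Λ * (x ⊗ₜ[k] (1 : H)) = comul (R := k) Λ * ((1 : H) ⊗ₜ[k] 𝒮 x) := by
  have e := congrArg (fun f : WithConv (H →ₗ[k] H ⊗[k] H) => f x)
    (toConv_comul_mul_antipode (k := k) (H := H))
  have e2 : ∑ i ∈ (ℛ k x).index, comul (R := k) ((ℛ k x).left i) *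
      ((1 : H) ⊗ₜ[k] 𝒮 ((ℛ k x).right i)) = x ⊗ₜ[k] (1 : H) := by
    exact ((ℛ k x).convMul_apply (toConv (comul (R := k) (A := H)))
      (toConv (ι₂ ∘ₗ 𝒮))).symm.trans e
  rw [← e2, Finset.mul_sum]
  have h3 : ∀ i ∈ (ℛ k x).index, comul (R := k) Λ * (comul (R := k) ((ℛ k x).left i) *
      ((1 : H) ⊗ₜ[k] 𝒮 ((ℛ k x).right i))) = comul (R := k) Λ *
      ((1 : H) ⊗ₜ[k] 𝒮 (counit (R := k) ((ℛ k x).left i) • (ℛ k x).right i)) := by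
    intro i _
    rw [← mul_assoc, ← Bialgebra.comul_mul, hΛ]
    simp
  rw [Finset.sum_congr rfl h3, ← Finset.mul_sum, ← TensorProduct.tmul_sum, ← map_sum,
    sum_counit_smul]

theorem one_tmul_mul_comul {Λ : H} (hΛ : ∀ h : H, h * Λ = counit (R := k) h • Λ) (x : H) :
    ((1 : H) ⊗ₜ[k] x) * comul (R := k) Λ = (𝒮 x ⊗ₜ[k] (1 : H)) * comul (R := k) Λ := by
  have e := congrArg (fun f : WithConv (H →ₗ[k] H ⊗[k] H) => f x)
    (toConv_antipode_mul_comul (k := k) (H := H))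
  have e2 : ∑ i ∈ (ℛ k x).index, (𝒮 ((ℛ k x).left i) ⊗ₜ[k] (1 : H)) *
      comul (R := k) ((ℛ k x).right i) = (1 : H) ⊗ₜ[k] x := by
    exact ((ℛ k x).convMul_apply (toConv (ι₁ ∘ₗ 𝒮))
      (toConv (comul (R := k) (A := H)))).symm.trans e
  have h4 : ∑ i ∈ (ℛ k x).index, counit (R := k) ((ℛ k x).right i) • (ℛ k x).left i = x := by
    have := congrArg (TensorProduct.rid k H) (sum_tmul_counit_eq (ℛ k x))
    simpa only [map_sum, TensorProduct.rid_tmul, one_smul] using this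
  rw [← e2, Finset.sum_mul]
  have h3 : ∀ i ∈ (ℛ k x).index, (𝒮 ((ℛ k x).left i) ⊗ₜ[k] (1 : H)) *
      comul (R := k) ((ℛ k x).right i) * comul (R := k) Λ =
      (𝒮 (counit (R := k) ((ℛ k x).right i) • (ℛ k x).left i) ⊗ₜ[k] (1 : H)) *
        comul (R := k) Λ := by
    intro i _
    rw [mul_assoc, ← Bialgebra.comul_mul, hΛ]
    rw [map_smul, map_smul, ← TensorProduct.smul_tmul', mul_smul_comm, smul_mul_assoc]
  rw [Finset.sum_congr rfl h3, ← Finset.sum_mul, ← TensorProduct.sum_tmul, ← map_sum, h4]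

theorem contractRight_mul_tmul_one (ξ : H →ₗ[k] k) (t : H ⊗[k] H) (x : H) :
    contractRight ξ (t * (x ⊗ₜ[k] (1 : H))) = contractRight ξ t * x := by
  induction t with
  | zero => simp
  | add a b ha hb => simp only [add_mul, map_add, ha, hb]
  | tmul a b => simp

theorem contractRight_tmul_one_mul (ξ : H →ₗ[k] k) (t : H ⊗[k] H) (x : H) :
    contractRight ξ ((x ⊗ₜ[k] (1 : H)) * t) = x * contractRight ξ t := by
  induction t with
  | zero => simp
  | add a b ha hb => simp only [mul_add, map_add, ha, hb]
  | tmul a b => simp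

theorem contractLeft_mul_one_tmul (ξ : H →ₗ[k] k) (t : H ⊗[k] H) (x : H) :
    contractLeft ξ (t * ((1 : H) ⊗ₜ[k] x)) = contractLeft ξ t * x := by
  induction t with
  | zero => simp
  | add a b ha hb => simp only [add_mul, map_add, ha, hb]
  | tmul a b => simp

theorem apply_contractRight (ξ μ : H →ₗ[k] k) (t : H ⊗[k] H) :
    μ (contractRight ξ t) = ξ (contractLeft μ t) := by
  induction t with
  | zero => simp
  | add a b ha hb => simp only [map_add, ha, hb]
  | tmul a b => simp [mul_comm]

variable {Λ : H}

theorem antipode_injective (hΛ : ∀ h : H, Λ * h = counit (R := k) h • Λ)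
    {ξ : H →ₗ[k] k} (hξ : IsLeftIntegral ξ) (h1 : ξ Λ = 1) :
    Function.Injective 𝒮 := by
  rw [injective_iff_map_eq_zero]
  intro x hx
  have e := congrArg (contractRight ξ) (comul_mul_tmul_one hΛ x)
  rw [contractRight_mul_tmul_one, hξ, h1, hx] at e
  simpa using e

theorem IsLeftIntegral.eq_zero_of_mul (hΛ : ∀ h : H, h * Λ = counit (R := k) h • Λ)
    (hS : Function.Injective 𝒮)
    {ξ : H →ₗ[k] k} (hξ : IsLeftIntegral ξ) (h1 : ξ Λ = 1) {x : H} (hx : ∀ y, ξ (x * y) = 0) :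
    x = 0 := by
  have e := congrArg (contractRight ξ) (one_tmul_mul_comul hΛ x)
  rw [contractRight_tmul_one_mul, hξ, h1] at e
  have h2 : ∀ t : H ⊗[k] H, contractRight ξ (((1 : H) ⊗ₜ[k] x) * t) = 0 := by
    intro t
    induction t with
    | zero => simp
    | add a b ha hb => simp only [mul_add, map_add, ha, hb, add_zero]
    | tmul a b => simp [hx]
  rw [h2] at e
  exact hS (by simpa using e.symm)

/-- Uniqueness of integrals. -/
theorem IsLeftIntegral.apply_antipode (hΛ : ∀ h : H, Λ * h = counit (R := k) h • Λ)
    {ξ μ : H →ₗ[k] k} (hξ : IsLeftIntegral ξ) (hμ : IsRightIntegral μ) (y : H) :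
    ξ (𝒮 y) * μ Λ = ξ Λ * μ y := by
  have e := congrArg (fun t => μ (contractRight ξ t)) (comul_mul_tmul_one hΛ y)
  rw [contractRight_mul_tmul_one, apply_contractRight, contractLeft_mul_one_tmul, hξ, hμ] at e
  simp at e
  rw [e, mul_comm]

theorem IsLeftIntegral.comp_antipode (hS : Function.Injective 𝒮)
    {ξ : H →ₗ[k] k} (hξ : IsLeftIntegral ξ) : IsRightIntegral (ξ ∘ₗ 𝒮) := by
  intro h
  apply hS
  have e := hξ (𝒮 h)
  rw [comul_antipode] at e
  simp only [map_smul, antipode_one, LinearMap.comp_apply]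
  rw [← e]
  generalize comul (R := k) h = t
  induction t with
  | zero => simp
  | add x y hx hy => simp only [map_add, hx, hy]
  | tmul x y => simp

theorem antipode_integral (hl : ∀ h : H, h * Λ = counit (R := k) h • Λ)
    (h1 : counit (R := k) Λ = 1) (hS : Function.Surjective 𝒮) : 𝒮 Λ = Λ := by
  have h2 : 𝒮 Λ * Λ = Λ := by rw [hl]; simp [h1]
  have h3 : 𝒮 Λ * Λ = 𝒮 Λ := by
    obtain ⟨y, hy⟩ := hS Λ
    have hy1 : counit (R := k) y = 1 := by rw [← counit_antipode (R := k) y, hy, h1]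
    nth_rewrite 2 [← hy]
    rw [← antipode_mul_antidistrib, hl, hy1, one_smul]
  rw [← h3, h2]

end Integrals

section TraceIntegral

theorem comp_contractLeft_comul (ξ : H →ₗ[k] k) (g : H →ₗ[k] H) (x : H) :
    g (contractLeft ξ (comul (R := k) x)) =
      (toConv (Algebra.linearMap k H ∘ₗ ξ) * toConv g) x := by
  rw [LinearMap.convMul_apply]
  generalize comul (R := k) x = t
  induction t with
  | zero => simp
  | add x y hx hy => simp only [map_add, hx, hy]
  | tmul x y =>
    simp only [contractLeft_tmul, map_smul]
    rw [Algebra.smul_def]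
    simp

theorem contractLeft_tmul_mul_map_comul (ξ : H →ₗ[k] k) (f g : H →ₗ[k] H) (u v x : H) :
    contractLeft ξ ((u ⊗ₜ[k] v) * TensorProduct.map f g (comul (R := k) x)) =
      (toConv (Algebra.linearMap k H ∘ₗ ξ ∘ₗ LinearMap.mulLeft k u ∘ₗ f) *
        toConv (LinearMap.mulLeft k v ∘ₗ g)) x := by
  rw [LinearMap.convMul_apply]
  generalize comul (R := k) x = t
  induction t with
  | zero => simp
  | add x y hx hy => simp only [map_add, mul_add, hx, hy]
  | tmul x y => simp [Algebra.smul_def]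

theorem sum_antipode_antipode_mul_antipode {ι : Type*} {x : H} (r : Repr k x ι) :
    ∑ i ∈ r.index, 𝒮 (𝒮 (r.right i)) * 𝒮 (r.left i) = counit (R := k) x • (1 : H) := by
  have h := congrArg 𝒮 (sum_mul_antipode_eq_smul r)
  simpa [antipode_mul_antidistrib] using h

section

variable {ι : Type*} [Fintype ι] (b : Module.Basis ι k H)

theorem sum_coord_mul_apply (p : H →ₗ[k] k) (y c : H) :
    ∑ j, b.coord j y * p (b j * c) = p (y * c) := by
  have h := congrArg (fun z => p (z * c)) (b.sum_repr y)
  simpa only [Finset.sum_mul, map_sum, smul_mul_assoc, map_smul, smul_eq_mul,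
    Module.Basis.coord_apply] using h

theorem smul_convOne_apply (r : k) (x : H) :
    (r • (1 : WithConv (H →ₗ[k] H))) x = algebraMap k H (counit x * r) := by
  change r • algebraMap k H (counit x) = _
  rw [Algebra.smul_def, ← map_mul, mul_comm]

theorem sum_conv_coord (p : H →ₗ[k] k) (u : H) :
    ∑ j, toConv (Algebra.linearMap k H ∘ₗ p ∘ₗ LinearMap.mulLeft k (b j) ∘ₗ 𝒮) *
      toConv (Algebra.linearMap k H ∘ₗ b.coord j ∘ₗ LinearMap.mulLeft k u ∘ₗ 𝒮 ∘ₗ 𝒮) =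
      p u • (1 : WithConv (H →ₗ[k] H)) := by
  refine WithConv.ext (LinearMap.ext fun x => ?_)
  rw [WithConv.ofConv_sum, LinearMap.sum_apply]
  simp_rw [(ℛ k x).convMul_apply]
  rw [Finset.sum_comm]
  have h1 : ∀ i ∈ (ℛ k x).index,
      ∑ j, (algebraMap k H) (p (b j * 𝒮 ((ℛ k x).left i))) *
        (algebraMap k H) (b.coord j (u * 𝒮 (𝒮 ((ℛ k x).right i)))) =
      algebraMap k H (p (u * (𝒮 (𝒮 ((ℛ k x).right i)) * 𝒮 ((ℛ k x).left i)))) := by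
    intro i _
    simp_rw [← map_mul, ← map_sum]
    congr 1
    rw [← mul_assoc, ← sum_coord_mul_apply b]
    simp_rw [mul_comm]
  refine (Finset.sum_congr rfl h1).trans ?_
  rw [← map_sum, ← map_sum, ← Finset.mul_sum, sum_antipode_antipode_mul_antipode,
    mul_smul_comm, mul_one, map_smul, smul_eq_mul]
  exact (smul_convOne_apply _ _).symm

theorem sum_contractLeft_coord (p : H →ₗ[k] k) (h x : H) :
    ∑ j, contractLeft (b.coord j) (comul (R := k) (h * 𝒮 (𝒮 (contractLeft
      (p ∘ₗ LinearMap.mulLeft k (b j) ∘ₗ 𝒮) (comul (R := k) x))))) =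
      contractLeft p (comul (R := k) h) * 𝒮 (𝒮 x) := by
  simp_rw [Bialgebra.comul_mul, comul_antipode_antipode]
  generalize comul (R := k) h = t
  induction t with
  | zero => simp
  | add t t' ht ht' =>
    simp only [map_add, add_mul, Finset.sum_add_distrib, ht, ht']
  | tmul u v =>
    have h1 : ∀ j ∈ Finset.univ, contractLeft (b.coord j) ((u ⊗ₜ[k] v) *
        TensorProduct.map (𝒮 ∘ₗ 𝒮) (𝒮 ∘ₗ 𝒮) (comul (R := k) (contractLeft
          (p ∘ₗ LinearMap.mulLeft k (b j) ∘ₗ 𝒮) (comul (R := k) x)))) =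
        ((toConv (Algebra.linearMap k H ∘ₗ p ∘ₗ LinearMap.mulLeft k (b j) ∘ₗ 𝒮) *
      toConv (Algebra.linearMap k H ∘ₗ b.coord j ∘ₗ LinearMap.mulLeft k u ∘ₗ 𝒮 ∘ₗ 𝒮)) *
        toConv (LinearMap.mulLeft k v ∘ₗ 𝒮 ∘ₗ 𝒮)) x := by
      intro j _
      rw [contractLeft_tmul_mul_map_comul, comp_contractLeft_comul, mul_assoc]
    rw [Finset.sum_congr rfl h1, ← LinearMap.sum_apply, ← WithConv.ofConv_sum,
      ← Finset.sum_mul, sum_conv_coord]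
    simp

/-- `p(x₍₁₎ S(x₍₂₎)) x₍₃₎ = p(1) x`. -/
theorem sum_contractLeft_comp (p : H →ₗ[k] k) (x : H) :
    ∑ j, contractLeft (p ∘ₗ LinearMap.mulLeft k (b j) ∘ₗ 𝒮) (comul (R := k)
      (contractLeft (b.coord j) (comul (R := k) x))) = p 1 • x := by
  have h0 : ∑ j, toConv (Algebra.linearMap k H ∘ₗ b.coord j) *
      toConv (Algebra.linearMap k H ∘ₗ p ∘ₗ LinearMap.mulLeft k (b j) ∘ₗ 𝒮) =
      p 1 • (1 : WithConv (H →ₗ[k] H)) := by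
    refine WithConv.ext (LinearMap.ext fun x => ?_)
    rw [WithConv.ofConv_sum, LinearMap.sum_apply]
    simp_rw [(ℛ k x).convMul_apply]
    rw [Finset.sum_comm]
    have h1 : ∀ i ∈ (ℛ k x).index,
        ∑ j, (algebraMap k H) (b.coord j ((ℛ k x).left i)) *
          (algebraMap k H) (p (b j * 𝒮 ((ℛ k x).right i))) =
        algebraMap k H (p ((ℛ k x).left i * 𝒮 ((ℛ k x).right i))) := by
      intro i _
      simp_rw [← map_mul, ← map_sum]
      congr 1
      exact sum_coord_mul_apply b _ _ _
    refine (Finset.sum_congr rfl h1).trans ?_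
    rw [← map_sum, ← map_sum, sum_mul_antipode_eq_smul, map_smul, smul_eq_mul]
    exact (smul_convOne_apply _ _).symm
  have h1 : ∀ j ∈ Finset.univ, contractLeft (p ∘ₗ LinearMap.mulLeft k (b j) ∘ₗ 𝒮) (comul (R := k)
      (contractLeft (b.coord j) (comul (R := k) x))) =
      ((toConv (Algebra.linearMap k H ∘ₗ b.coord j) *
      toConv (Algebra.linearMap k H ∘ₗ p ∘ₗ LinearMap.mulLeft k (b j) ∘ₗ 𝒮)) *
        toConv (LinearMap.id : H →ₗ[k] H)) x := by
    intro j _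
    rw [mul_assoc]
    refine (comp_contractLeft_comul (b.coord j)
      (contractLeft (p ∘ₗ LinearMap.mulLeft k (b j) ∘ₗ 𝒮) ∘ₗ comul (R := k)) x).trans ?_
    congr 3
    refine WithConv.ext (LinearMap.ext fun y => ?_)
    exact comp_contractLeft_comul _ LinearMap.id y
  rw [Finset.sum_congr rfl h1, ← LinearMap.sum_apply, ← WithConv.ofConv_sum,
    ← Finset.sum_mul, h0]
  simp

end

variable (k H) in
/-- The linear functional `h ↦ Tr(x ↦ h S²(x))`. -/
noncomputable def traceIntegral : H →ₗ[k] k :=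
  LinearMap.trace k H ∘ₗ LinearMap.mulRight k (𝒮 ∘ₗ 𝒮 : Module.End k H) ∘ₗ
    (Algebra.lmul k H).toLinearMap

theorem traceIntegral_apply (h : H) :
    traceIntegral k H h = LinearMap.trace k H (LinearMap.mulLeft k h ∘ₗ 𝒮 ∘ₗ 𝒮) := rfl

theorem traceIntegral_one : traceIntegral k H 1 = LinearMap.trace k H (𝒮 ∘ₗ 𝒮) := by
  rw [traceIntegral_apply]; congr 1; ext; simp

theorem traceIntegral_mul (x y : H) :
    traceIntegral k H (x * y) = traceIntegral k H (y * 𝒮 (𝒮 x)) := by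
  simp only [traceIntegral_apply]
  have h1 : LinearMap.mulLeft k (x * y) ∘ₗ 𝒮 ∘ₗ 𝒮 =
      LinearMap.mulLeft k x * (LinearMap.mulLeft k y ∘ₗ 𝒮 ∘ₗ 𝒮) := by
    ext z; simp
  have h2 : LinearMap.mulLeft k (y * 𝒮 (𝒮 x)) ∘ₗ 𝒮 ∘ₗ 𝒮 =
      (LinearMap.mulLeft k y ∘ₗ 𝒮 ∘ₗ 𝒮) * LinearMap.mulLeft k x := by
    ext z; simp [antipode_mul_antidistrib]
  rw [h1, h2, LinearMap.trace_mul_comm]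

variable [FiniteDimensional k H]

theorem isLeftIntegral_traceIntegral : IsLeftIntegral (traceIntegral k H) := by
  intro h
  rw [← sub_eq_zero, ← Module.forall_dual_apply_eq_zero_iff k]
  intro p
  rw [map_sub, apply_contractRight, map_smul, sub_eq_zero]
  let b := Module.finBasis k H
  let D : (H →ₗ[k] k) → Module.End k H := fun q => contractLeft q ∘ₗ comul (R := k)
  let f : Module.End k H := LinearMap.mulLeft k h ∘ₗ 𝒮 ∘ₗ 𝒮
  let r := fun j => p ∘ₗ LinearMap.mulLeft k (b j) ∘ₗ 𝒮
  have h1 : LinearMap.mulLeft k (contractLeft p (comul (R := k) h)) ∘ₗ 𝒮 ∘ₗ 𝒮 =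
      ∑ j, D (b.coord j) * f * D (r j) := by
    ext x
    rw [LinearMap.sum_apply]
    exact (sum_contractLeft_coord b p h x).symm
  have h2 : ∑ j, D (r j) * D (b.coord j) = p 1 • (1 : Module.End k H) := by
    ext x
    rw [LinearMap.sum_apply]
    exact sum_contractLeft_comp b p x
  rw [traceIntegral_apply, h1, map_sum]
  simp_rw [mul_assoc, LinearMap.trace_mul_comm k (D (b.coord _)), mul_assoc]
  rw [← map_sum, ← Finset.mul_sum, h2]
  simp [traceIntegral_apply, f, mul_comm]

theorem traceIntegral_integral {Λ : H} (hΛ : ∀ h : H, Λ * h = counit (R := k) h • Λ)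
    (h1 : counit (R := k) Λ = 1) : traceIntegral k H Λ = 1 := by
  have : LinearMap.mulLeft k Λ ∘ₗ 𝒮 ∘ₗ 𝒮 = (counit (R := k) (A := H)).smulRight Λ := by
    ext x; simp [hΛ]
  rw [traceIntegral_apply, this, LinearMap.trace_smulRight, h1]

end TraceIntegral

section HaarIntegral

/-! ### The Haar integral and the distinguished grouplike element -/

variable (k) in
/-- A two-sided integral of counit one. -/
structure IsHaarIntegral (Λ : H) : Prop where
  mul_left : ∀ h : H, h * Λ = counit (R := k) h • Λ
  mul_right : ∀ h : H, Λ * h = counit (R := k) h • Λ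
  counit_eq : counit (R := k) Λ = 1

theorem isLeftIntegral_iff (ξ : H →ₗ[k] k) : IsLeftIntegral ξ ↔
    toConv (LinearMap.id : H →ₗ[k] H) * toConv (Algebra.linearMap k H ∘ₗ ξ) =
      toConv (Algebra.linearMap k H ∘ₗ ξ) := by
  have key (x : H) : contractRight ξ (comul (R := k) x) =
      (toConv (LinearMap.id : H →ₗ[k] H) * toConv (Algebra.linearMap k H ∘ₗ ξ)) x := by
    rw [LinearMap.convMul_apply]
    generalize comul (R := k) x = t
    induction t with
    | zero => simp
    | add x y hx hy => simp only [map_add, hx, hy]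
    | tmul x y => simp [Algebra.smul_def, Algebra.commutes]
  constructor
  · intro h
    refine WithConv.ext (LinearMap.ext fun x => (key x).symm.trans ?_)
    rw [h x, ← Algebra.algebraMap_eq_smul_one]
    rfl
  · intro h x
    rw [key, h, ← Algebra.algebraMap_eq_smul_one]
    rfl

theorem IsLeftIntegral.comp_contractLeft {ξ : H →ₗ[k] k} (hξ : IsLeftIntegral ξ)
    (p : H →ₗ[k] k) : IsLeftIntegral (p ∘ₗ contractLeft ξ ∘ₗ comul (R := k)) := by
  have h : toConv (Algebra.linearMap k H ∘ₗ p ∘ₗ contractLeft ξ ∘ₗ comul (R := k)) =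
      toConv (Algebra.linearMap k H ∘ₗ ξ) * toConv (Algebra.linearMap k H ∘ₗ p) :=
    WithConv.ext (LinearMap.ext fun x =>
      comp_contractLeft_comul ξ (Algebra.linearMap k H ∘ₗ p) x)
  rw [isLeftIntegral_iff] at hξ ⊢
  rw [h, ← mul_assoc, hξ]

theorem comul_contractLeft_comul (ξ : H →ₗ[k] k) (x : H) :
    comul (R := k) (contractLeft ξ (comul (R := k) x)) =
      TensorProduct.map (contractLeft ξ ∘ₗ comul (R := k)) LinearMap.id (comul (R := k) x) := by
  have h1 (t : H ⊗[k] H) : comul (R := k) (contractLeft ξ t) =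
      TensorProduct.lid k (H ⊗[k] H) (TensorProduct.map ξ LinearMap.id
        ((comul (R := k)).lTensor H t)) := by
    induction t with
    | zero => simp
    | add x y hx hy => simp only [map_add, hx, hy]
    | tmul x y => simp
  have h2 (t : H ⊗[k] H) :
      TensorProduct.map (contractLeft ξ ∘ₗ comul (R := k)) LinearMap.id t =
      TensorProduct.lid k (H ⊗[k] H) (TensorProduct.map ξ LinearMap.id
        (TensorProduct.assoc k H H H ((comul (R := k)).rTensor H t))) := by
    induction t with
    | zero => simp
    | add x y hx hy => simp only [map_add, hx, hy]
    | tmul x y =>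
      simp only [map_tmul, LinearMap.comp_apply, LinearMap.rTensor_tmul, LinearMap.id_apply]
      generalize comul (R := k) x = s
      induction s with
      | zero => simp
      | add u v hu hv => simp only [map_add, add_tmul, hu, hv]
      | tmul u v => simp [smul_tmul']
  rw [h1, h2, coassoc_apply]

theorem IsGroupLikeElem.exists_pow_eq_one [FiniteDimensional k H] {a : H}
    (ha : IsGroupLikeElem k a) : ∃ m : ℕ, 0 < m ∧ a ^ m = 1 := by
  have : Finite (GroupLike k H) := (linearIndep_groupLikeVal (R := k) (A := H)).finite
  obtain ⟨m, hm, h⟩ := isOfFinOrder_iff_pow_eq_one.1 (isOfFinOrder_of_finite (⟨a, ha⟩ : GroupLike k H))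
  exact ⟨m, hm, by simpa using congrArg GroupLike.val h⟩

variable [FiniteDimensional k H] {Λ : H}

namespace IsHaarIntegral

theorem traceIntegral_eq (hΛ : IsHaarIntegral k Λ) : traceIntegral k H Λ = 1 :=
  traceIntegral_integral hΛ.mul_right hΛ.counit_eq

theorem antipode_injective (hΛ : IsHaarIntegral k Λ) : Function.Injective 𝒮 :=
  HopfAlgebra.antipode_injective hΛ.mul_right isLeftIntegral_traceIntegral hΛ.traceIntegral_eq

theorem antipode_surjective (hΛ : IsHaarIntegral k Λ) : Function.Surjective 𝒮 :=
  LinearMap.injective_iff_surjective.1 hΛ.antipode_injective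

theorem antipode_eq (hΛ : IsHaarIntegral k Λ) : 𝒮 Λ = Λ :=
  antipode_integral hΛ.mul_left hΛ.counit_eq hΛ.antipode_surjective

theorem isRightIntegral_traceIntegral_comp (hΛ : IsHaarIntegral k Λ) :
    IsRightIntegral (traceIntegral k H ∘ₗ 𝒮) :=
  isLeftIntegral_traceIntegral.comp_antipode hΛ.antipode_injective

theorem leftIntegral_apply (hΛ : IsHaarIntegral k Λ) {ξ : H →ₗ[k] k} (hξ : IsLeftIntegral ξ)
    (y : H) : ξ y = ξ Λ * traceIntegral k H y := by
  obtain ⟨y, rfl⟩ := hΛ.antipode_surjective y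
  have h := hξ.apply_antipode hΛ.mul_right hΛ.isRightIntegral_traceIntegral_comp y
  simpa [hΛ.antipode_eq, hΛ.traceIntegral_eq] using h

theorem rightIntegral_apply (hΛ : IsHaarIntegral k Λ) {μ : H →ₗ[k] k} (hμ : IsRightIntegral μ)
    (y : H) : μ y = μ Λ * traceIntegral k H (𝒮 y) := by
  have h := isLeftIntegral_traceIntegral.apply_antipode hΛ.mul_right hμ y
  rw [hΛ.traceIntegral_eq] at h
  rw [mul_comm, h, one_mul]

theorem eq_zero_of_traceIntegral_mul (hΛ : IsHaarIntegral k Λ) {x : H}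
    (hx : ∀ y, traceIntegral k H (x * y) = 0) : x = 0 :=
  isLeftIntegral_traceIntegral.eq_zero_of_mul hΛ.mul_left hΛ.antipode_injective
    hΛ.traceIntegral_eq hx

theorem eq_zero_of_mul_traceIntegral (hΛ : IsHaarIntegral k Λ) {x : H}
    (hx : ∀ y, traceIntegral k H (y * x) = 0) : x = 0 := by
  refine hΛ.eq_zero_of_traceIntegral_mul fun y => ?_
  obtain ⟨y, rfl⟩ := hΛ.antipode_surjective y
  obtain ⟨y, rfl⟩ := hΛ.antipode_surjective y
  rw [← traceIntegral_mul, hx]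

theorem contractLeft_comul (hΛ : IsHaarIntegral k Λ) (h : H) :
    contractLeft (traceIntegral k H) (comul (R := k) h) =
      traceIntegral k H h • contractLeft (traceIntegral k H) (comul (R := k) Λ) := by
  rw [← sub_eq_zero, ← Module.forall_dual_apply_eq_zero_iff k]
  intro p
  rw [map_sub, map_smul, sub_eq_zero, smul_eq_mul, mul_comm]
  exact hΛ.leftIntegral_apply (isLeftIntegral_traceIntegral.comp_contractLeft p) h

theorem isGroupLikeElem_contractLeft (hΛ : IsHaarIntegral k Λ) :
    IsGroupLikeElem k (contractLeft (traceIntegral k H) (comul (R := k) Λ)) := by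
  constructor
  · have h (t : H ⊗[k] H) : counit (R := k) (contractLeft (traceIntegral k H) t) =
        traceIntegral k H (TensorProduct.rid k H ((counit (R := k)).lTensor H t)) := by
      induction t with
      | zero => simp
      | add x y hx hy => simp only [map_add, hx, hy]
      | tmul x y => simp [mul_comm]
    rw [h, lTensor_counit_comul]
    simp [hΛ.traceIntegral_eq]
  · set a := contractLeft (traceIntegral k H) (comul (R := k) Λ) with ha
    have h (t : H ⊗[k] H) :
        TensorProduct.map (contractLeft (traceIntegral k H) ∘ₗ comul (R := k)) LinearMap.id t =
          a ⊗ₜ[k] contractLeft (traceIntegral k H) t := by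
      induction t with
      | zero => simp
      | add x y hx hy => simp only [map_add, hx, hy, tmul_add]
      | tmul x y => simp [hΛ.contractLeft_comul x, ← ha, smul_tmul']
    conv_lhs => rw [ha, comul_contractLeft_comul, h, ← ha]

theorem traceIntegral_antipode (hΛ : IsHaarIntegral k Λ) (h : H) :
    traceIntegral k H (𝒮 h) =
      traceIntegral k H (h * contractLeft (traceIntegral k H) (comul (R := k) Λ)) := by
  have hg := hΛ.isGroupLikeElem_contractLeft
  have hc := hΛ.contractLeft_comul
  set a := contractLeft (traceIntegral k H) (comul (R := k) Λ)
  have hμ : IsRightIntegral (traceIntegral k H ∘ₗ LinearMap.mulRight k a) := by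
    intro h
    have h1 (t : H ⊗[k] H) : contractLeft (traceIntegral k H ∘ₗ LinearMap.mulRight k a) t * a =
        contractLeft (traceIntegral k H) (t * (a ⊗ₜ[k] a)) := by
      induction t with
      | zero => simp
      | add x y hx hy => simp only [map_add, add_mul, hx, hy]
      | tmul x y => simp
    refine hg.isUnit.mul_left_injective ?_
    simp only [h1, ← hg.comul_eq_tmul_self, ← Bialgebra.comul_mul, hc]
    simp
  have h2 := hΛ.rightIntegral_apply hμ h
  simp only [LinearMap.comp_apply, LinearMap.mulRight_apply, hΛ.mul_right, hg.counit_eq_one,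
    one_smul, hΛ.traceIntegral_eq, one_mul] at h2
  exact h2.symm

theorem mul_contractLeft (hΛ : IsHaarIntegral k Λ) (y : H) :
    y * contractLeft (traceIntegral k H) (comul (R := k) Λ) =
      contractLeft (traceIntegral k H) (comul (R := k) Λ) * 𝒮 (𝒮 (𝒮 (𝒮 y))) := by
  have ht := hΛ.traceIntegral_antipode
  set a := contractLeft (traceIntegral k H) (comul (R := k) Λ)
  rw [← sub_eq_zero]
  refine hΛ.eq_zero_of_mul_traceIntegral fun x => ?_
  rw [mul_sub, map_sub, sub_eq_zero, ← mul_assoc, ← mul_assoc, ← ht,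
    antipode_mul_antidistrib, traceIntegral_mul, ← antipode_mul_antidistrib, ht, mul_assoc,
    traceIntegral_mul]

theorem exists_antipode_pow_eq_one (hΛ : IsHaarIntegral k Λ) :
    ∃ m : ℕ, 0 < m ∧ (𝒮 ∘ₗ 𝒮 : Module.End k H) ^ m = 1 := by
  have hg := hΛ.isGroupLikeElem_contractLeft
  have hm := hΛ.mul_contractLeft
  set a := contractLeft (traceIntegral k H) (comul (R := k) Λ)
  obtain ⟨m, h0, h1⟩ := IsGroupLikeElem.exists_pow_eq_one hg
  refine ⟨2 * m, by omega, ?_⟩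
  have key (j : ℕ) (y : H) :
      y * a ^ j = a ^ j * ((𝒮 ∘ₗ 𝒮 : Module.End k H) ^ (2 * j)) y := by
    induction j generalizing y with
    | zero => simp
    | succ j ih =>
      rw [pow_succ', ← mul_assoc, hm, mul_assoc, ih, ← mul_assoc, mul_add_one, pow_add]
      rfl
  ext y
  simpa [h1] using (key m y).symm

theorem traceIntegral_antipode_of_ne_zero (hΛ : IsHaarIntegral k Λ)
    (ht : LinearMap.trace k H (𝒮 ∘ₗ 𝒮) ≠ 0) (h : H) :
    traceIntegral k H (𝒮 h) = traceIntegral k H h := by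
  have e := apply_contractRight (traceIntegral k H) (traceIntegral k H ∘ₗ 𝒮) (comul (R := k) h)
  rw [isLeftIntegral_traceIntegral, hΛ.isRightIntegral_traceIntegral_comp] at e
  simp only [map_smul, LinearMap.comp_apply, antipode_one, smul_eq_mul, traceIntegral_one] at e
  exact (mul_right_cancel₀ ht e).symm

theorem antipode_pow_four_of_ne_zero (hΛ : IsHaarIntegral k Λ)
    (ht : LinearMap.trace k H (𝒮 ∘ₗ 𝒮) ≠ 0) (h : H) : 𝒮 (𝒮 (𝒮 (𝒮 h))) = h := by
  have h1 : traceIntegral k H ∘ₗ 𝒮 = traceIntegral k H :=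
    LinearMap.ext (hΛ.traceIntegral_antipode_of_ne_zero ht)
  have h2 := hΛ.isRightIntegral_traceIntegral_comp
  rw [h1] at h2
  have h3 := hΛ.mul_contractLeft h
  rw [h2, hΛ.traceIntegral_eq] at h3
  simpa using h3.symm

end IsHaarIntegral

end HaarIntegral

section SquareAntipode

/-! ### The square of the antipode -/

theorem sum_contractLeft_mul_contractLeft {ι : Type*} [Fintype ι] (b : Module.Basis ι k H)
    (p : H →ₗ[k] k) (s t : H ⊗[k] H) :
    ∑ j, contractLeft (b.coord j) s * contractLeft (p ∘ₗ LinearMap.mulLeft k (b j)) t =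
      contractLeft p (s * t) := by
  induction s with
  | zero => simp
  | add x y hx hy => simp only [map_add, add_mul, Finset.sum_add_distrib, hx, hy]
  | tmul x y =>
    induction t with
    | zero => simp
    | add u v hu hv => simp only [map_add, mul_add, Finset.sum_add_distrib, hu, hv]
    | tmul u v =>
      simp only [contractLeft_tmul, LinearMap.comp_apply, LinearMap.mulLeft_apply,
        smul_mul_smul_comm, Algebra.TensorProduct.tmul_mul_tmul]
      rw [← Finset.sum_smul, sum_coord_mul_apply]

variable (k H) in
/-- The linear map `h ⊗ g ↦ h g₍₁₎ ⊗ g₍₂₎`. -/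
noncomputable def galoisMap : H ⊗[k] H →ₗ[k] H ⊗[k] H :=
  TensorProduct.lift ((LinearMap.mul k (H ⊗[k] H)).compl₁₂ ι₁ (comul (R := k)))

theorem galoisMap_tmul (h g : H) :
    galoisMap k H (h ⊗ₜ[k] g) = (h ⊗ₜ[k] (1 : H)) * comul (R := k) g := by
  simp [galoisMap]

theorem galoisMap_surjective : Function.Surjective (galoisMap k H) := by
  rw [← LinearMap.range_eq_top, eq_top_iff]
  rintro t -
  induction t with
  | zero => exact zero_mem _
  | add x y hx hy => exact add_mem hx hy
  | tmul u v =>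
    have e := congrArg (fun f : WithConv (H →ₗ[k] H ⊗[k] H) => f v)
      (toConv_antipode_mul_comul (k := k) (H := H))
    have e2 : ∑ i ∈ (ℛ k v).index, (𝒮 ((ℛ k v).left i) ⊗ₜ[k] (1 : H)) *
        comul (R := k) ((ℛ k v).right i) = (1 : H) ⊗ₜ[k] v :=
      ((ℛ k v).convMul_apply (toConv (ι₁ ∘ₗ 𝒮))
        (toConv (comul (R := k) (A := H)))).symm.trans e
    refine ⟨∑ i ∈ (ℛ k v).index, (u * 𝒮 ((ℛ k v).left i)) ⊗ₜ[k] (ℛ k v).right i, ?_⟩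
    rw [map_sum, show u ⊗ₜ[k] v = (u ⊗ₜ[k] (1 : H)) * ((1 : H) ⊗ₜ[k] v) by simp, ← e2,
      Finset.mul_sum]
    refine Finset.sum_congr rfl fun i _ => ?_
    rw [galoisMap_tmul, ← mul_assoc]
    simp

/-- The left translation `h ↦ p(h₍₁₎) h₍₂₎`. -/
noncomputable def translation (p : H →ₗ[k] k) : Module.End k H :=
  contractLeft p ∘ₗ comul (R := k)

theorem translation_apply (p : H →ₗ[k] k) (h : H) :
    translation p h = contractLeft p (comul (R := k) h) := rfl

theorem galoisMap_comp_sum_translation {ι : Type*} [Fintype ι] (b : Module.Basis ι k H)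
    (p : H →ₗ[k] k) :
    galoisMap k H ∘ₗ (∑ j, TensorProduct.map (translation (b.coord j))
      (translation (p ∘ₗ LinearMap.mulLeft k (b j)))) =
      TensorProduct.map (translation p) LinearMap.id ∘ₗ galoisMap k H := by
  ext h g
  simp only [AlgebraTensorModule.curry_apply, curry_apply, LinearMap.coe_restrictScalars,
    LinearMap.comp_apply, LinearMap.sum_apply, map_tmul, map_sum, galoisMap_tmul]
  simp only [translation_apply, comul_contractLeft_comul]
  simp only [← translation_apply]
  generalize comul (R := k) g = t
  induction t with
  | zero => simp
  | add x y hx hy => simp only [map_add, mul_add, Finset.sum_add_distrib, hx, hy]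
  | tmul u v =>
    change ∑ j, translation (b.coord j) h ⊗ₜ[k] (1 : H) *
      (translation (p ∘ₗ LinearMap.mulLeft k (b j)) u ⊗ₜ[k] v) = _
    simp only [Algebra.TensorProduct.tmul_mul_tmul, one_mul, map_tmul, LinearMap.id_apply,
      ← sum_tmul, translation_apply, sum_contractLeft_mul_contractLeft, Bialgebra.comul_mul]

section

variable [FiniteDimensional k H]

theorem exists_apply_eq_trace_translation :
    ∃ x : H, ∀ p : H →ₗ[k] k, p x = LinearMap.trace k H (translation p) := by
  let F : Module.Dual k (Module.Dual k H) :=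
    { toFun := fun p => LinearMap.trace k H (translation p)
      map_add' := fun p q => by
        rw [← map_add]
        congr 1
        ext h
        simp only [translation_apply, LinearMap.add_apply]
        generalize comul (R := k) h = t
        induction t with
        | zero => simp
        | add x y hx hy => simp only [map_add, hx, hy]; abel
        | tmul x y => simp [add_smul]
      map_smul' := fun c p => by
        rw [RingHom.id_apply, ← map_smul]
        congr 1
        ext h
        simp only [translation_apply, LinearMap.smul_apply]
        generalize comul (R := k) h = t
        induction t with
        | zero => simp
        | add x y hx hy => simp only [map_add, hx, hy, smul_add]
        | tmul x y => simp [smul_smul] }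
  refine ⟨(Module.evalEquiv k H).symm F, fun p => ?_⟩
  exact Module.apply_evalEquiv_symm_apply k H p F

theorem mul_self_of_apply_eq_trace {x : H}
    (hx : ∀ p : H →ₗ[k] k, p x = LinearMap.trace k H (translation p)) :
    x * x = (Module.finrank k H : k) • x := by
  rw [← sub_eq_zero, ← Module.forall_dual_apply_eq_zero_iff k]
  intro p
  rw [map_sub, map_smul, sub_eq_zero]
  let b := Module.finBasis k H
  let T : Module.End k (H ⊗[k] H) := ∑ j, TensorProduct.map (translation (b.coord j))
      (translation (p ∘ₗ LinearMap.mulLeft k (b j)))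
  let Φ := LinearEquiv.ofBijective (galoisMap k H)
    ⟨LinearMap.injective_iff_surjective.2 galoisMap_surjective, galoisMap_surjective⟩
  have h1 : Φ.conj T = TensorProduct.map (translation p) LinearMap.id := by
    refine LinearMap.ext fun t => ?_
    obtain ⟨t, rfl⟩ := Φ.surjective t
    rw [LinearEquiv.conj_apply_apply, Φ.symm_apply_apply]
    exact LinearMap.congr_fun (galoisMap_comp_sum_translation b p) t
  have h2 := congrArg (LinearMap.trace k (H ⊗[k] H)) h1
  rw [LinearMap.trace_conj', LinearMap.trace_tensorProduct', LinearMap.trace_id, map_sum] at h2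
  simp only [LinearMap.trace_tensorProduct', ← hx] at h2
  rw [smul_eq_mul, mul_comm, ← h2, ← sum_coord_mul_apply b]
  rfl

/-- The Larson–Radford theorem for a semisimple Hopf algebra: the antipode is an involution. -/
theorem IsHaarIntegral.antipode_antipode [IsAlgClosed k] [CharZero k] [IsSemisimpleRing H]
    {Λ : H} (hΛ : IsHaarIntegral k Λ) (h : H) : 𝒮 (𝒮 h) = h := by
  obtain ⟨m, hm, hσm⟩ := hΛ.exists_antipode_pow_eq_one
  have ht : LinearMap.trace k H (𝒮 ∘ₗ 𝒮) ≠ 0 := by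
    refine IsSemisimpleRing.trace_ne_zero_of_pow_eq_one (ξ := traceIntegral k H)
      traceIntegral_mul (fun x hx => hΛ.eq_zero_of_traceIntegral_mul hx) traceIntegral_apply ?_
      hm hσm
    intro h
    simpa [h] using hΛ.traceIntegral_eq
  have h4 := hΛ.antipode_pow_four_of_ne_zero ht
  have hright : IsRightIntegral (traceIntegral k H) := by
    have h1 : traceIntegral k H ∘ₗ 𝒮 = traceIntegral k H :=
      LinearMap.ext (hΛ.traceIntegral_antipode_of_ne_zero ht)
    rw [← h1]
    exact hΛ.isRightIntegral_traceIntegral_comp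
  obtain ⟨x, hx⟩ := exists_apply_eq_trace_translation (k := k) (H := H)
  let σ : Module.End k H := 𝒮 ∘ₗ 𝒮
  have hσ : σ * σ = 1 := LinearMap.ext h4
  have hσx : σ x = x := by
    rw [← sub_eq_zero, ← Module.forall_dual_apply_eq_zero_iff k]
    intro p
    rw [map_sub, sub_eq_zero]
    have h1 : translation p * σ = σ * translation (p ∘ₗ σ) := by
      ext y
      simp only [Module.End.mul_apply, translation_apply, σ, LinearMap.comp_apply,
        comul_antipode_antipode]
      generalize comul (R := k) y = t
      induction t with
      | zero => simp
      | add x y hx hy => simp only [map_add, hx, hy]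
      | tmul x y => simp
    have h2 : translation (p ∘ₗ σ) = σ * (translation p * σ) := by
      rw [h1, ← mul_assoc, hσ, one_mul]
    have h3 : p (σ x) = LinearMap.trace k H (translation (p ∘ₗ σ)) := hx (p ∘ₗ σ)
    rw [h3, h2, LinearMap.trace_mul_comm, mul_assoc, hσ, mul_one, hx]
  have hxx := mul_self_of_apply_eq_trace hx
  have hH : (1 : H) ≠ 0 := by
    intro h1
    have h2 := hΛ.counit_eq
    rw [← one_mul Λ, h1, zero_mul, map_zero] at h2
    exact zero_ne_one h2
  have key : σ = 1 := by
    refine Module.End.eq_one_of_involutive (E := LinearMap.mulLeft k x) hσ ?_ ?_ ?_ ht hH ?_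
    · ext y
      simp [← mul_assoc, hxx]
    · ext y
      simp only [Module.End.mul_apply, LinearMap.mulLeft_apply, σ, LinearMap.comp_apply,
        antipode_antipode_mul]
      rw [show 𝒮 (𝒮 x) = x from hσx]
    · change traceIntegral k H x = _
      have h1 : translation (traceIntegral k H) = (traceIntegral k H).smulRight (1 : H) :=
        LinearMap.ext hright
      rw [hx, h1, LinearMap.trace_smulRight, traceIntegral_one]
    · simp [σ]
  exact LinearMap.congr_fun key h

end

end SquareAntipode

/-! ### Invariant bilinear forms -/

theorem comul_contractRight_comul (ξ : H →ₗ[k] k) (x : H) :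
    comul (R := k) (contractRight ξ (comul (R := k) x)) =
      TensorProduct.map LinearMap.id (contractRight ξ ∘ₗ comul (R := k)) (comul (R := k) x) := by
  have h1 (t : H ⊗[k] H) : comul (R := k) (contractRight ξ t) =
      TensorProduct.rid k (H ⊗[k] H) (TensorProduct.map LinearMap.id ξ
        ((comul (R := k)).rTensor H t)) := by
    induction t with
    | zero => simp
    | add a b ha hb => simp only [map_add, ha, hb]
    | tmul a b => simp
  have h2 (t : (H ⊗[k] H) ⊗[k] H) :
      TensorProduct.rid k (H ⊗[k] H) (TensorProduct.map LinearMap.id ξ t) =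
      TensorProduct.map LinearMap.id (contractRight ξ) (TensorProduct.assoc k H H H t) := by
    induction t with
    | zero => simp
    | add a b ha hb => simp only [map_add, ha, hb]
    | tmul a b =>
      induction a with
      | zero => simp
      | add a c ha hc => simp only [TensorProduct.add_tmul, map_add, ha, hc]
      | tmul a c => simp
  rw [h1, h2, coassoc_apply]
  generalize comul (R := k) x = t
  induction t with
  | zero => simp
  | add a b ha hb => simp only [map_add, ha, hb]
  | tmul a b => simp

theorem counit_contractLeft_comul (ξ : H →ₗ[k] k) (x : H) :
    counit (R := k) (contractLeft ξ (comul (R := k) x)) = ξ x := by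
  rw [← apply_contractRight]
  exact congrArg ξ ((congrArg (TensorProduct.rid k H) (lTensor_counit_comul x)).trans (by simp))

theorem counit_contractRight_comul (ξ : H →ₗ[k] k) (x : H) :
    counit (R := k) (contractRight ξ (comul (R := k) x)) = ξ x := by
  rw [apply_contractRight]
  exact congrArg ξ ((congrArg (TensorProduct.lid k H) (rTensor_counit_comul x)).trans (by simp))

section InvariantForms

variable (ρ : H →ₐ[k] Module.End k V)

/-- The right action of `H ⊗ H` on bilinear forms: `(b · (x ⊗ y))(v, w) = b(x v, y w)`. -/
noncomputable def actForm (b : V →ₗ[k] V →ₗ[k] k) : H ⊗[k] H →ₗ[k] V →ₗ[k] V →ₗ[k] k :=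
  TensorProduct.lift (LinearMap.mk₂ k (fun x y => b.compl₁₂ (ρ x) (ρ y))
    (by intros; ext; simp) (by intros; ext; simp) (by intros; ext; simp) (by intros; ext; simp))

variable {ρ} {b : V →ₗ[k] V →ₗ[k] k}

@[simp] theorem actForm_tmul (x y : H) : actForm ρ b (x ⊗ₜ[k] y) = b.compl₁₂ (ρ x) (ρ y) := rfl

theorem actForm_mul (t s : H ⊗[k] H) :
    actForm ρ b (t * s) = actForm ρ (actForm ρ b t) s := by
  induction s with
  | zero => simp
  | add x y hx hy => rw [mul_add, map_add, map_add, hx, hy]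
  | tmul x y =>
    induction t with
    | zero => ext; simp
    | add x' y' hx hy => rw [add_mul, map_add, map_add, hx, hy]; ext; simp
    | tmul x' y' => ext; simp

theorem actForm_smul (c : k) (t : H ⊗[k] H) : actForm ρ (c • b) t = c • actForm ρ b t := by
  induction t with
  | zero => simp
  | add x y hx hy => rw [map_add, map_add, hx, hy, smul_add]
  | tmul x y => ext; simp

theorem actForm_add (b' : V →ₗ[k] V →ₗ[k] k) (t : H ⊗[k] H) :
    actForm ρ (b + b') t = actForm ρ b t + actForm ρ b' t := by
  induction t with
  | zero => simp
  | add x y hx hy => rw [map_add, map_add, map_add, hx, hy]; abel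
  | tmul x y => ext; simp

theorem isAlphaInvariantBil_iff {α : H →ₐ[k] k} :
    IsAlphaInvariantBil α ρ b ↔ ∀ h, actForm ρ b (comul h) = α h • b := by
  have key (t : H ⊗[k] H) (v w : V) : TensorProduct.lift b
        ((TensorProduct.homTensorHomMap (.id k) V V V V
            ((TensorProduct.map ρ.toLinearMap ρ.toLinearMap) t)) (v ⊗ₜ[k] w)) =
      actForm ρ b t v w := by
    induction t with
    | zero => simp
    | add x y hx hy => simp only [map_add, LinearMap.add_apply, hx, hy]
    | tmul x y => simp
  simp only [IsAlphaInvariantBil, key, LinearMap.ext_iff, LinearMap.smul_apply, smul_eq_mul]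

theorem trace_mul' [FiniteDimensional k V] {ι : Type*} [Fintype ι] [DecidableEq ι]
    (e : Module.Basis ι k V) (t : H ⊗[k] H) :
    LinearMap.trace k V (ρ (LinearMap.mul' k H t)) =
      ∑ i, ∑ j, actForm ρ ((e.coord i).smulRight (e.coord j)) t (e j) (e i) := by
  induction t with
  | zero => simp
  | add x y hx hy => simp only [map_add, hx, hy, LinearMap.add_apply, Finset.sum_add_distrib]
  | tmul x y =>
    rw [LinearMap.mul'_apply, map_mul, LinearMap.trace_eq_matrix_trace k e,
      LinearMap.toMatrix_mul, Matrix.trace]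
    simp [Matrix.mul_apply, LinearMap.toMatrix_apply]

theorem sum_coord_smulRight_coord {ι : Type*} [Fintype ι] (e : Module.Basis ι k V) :
    ∑ i, ∑ j, b (e i) (e j) • (e.coord i).smulRight (e.coord j) = b := by
  classical
  refine e.ext fun i' => e.ext fun j' => ?_
  simp [LinearMap.sum_apply, Finsupp.single_apply]

theorem nuL_eq (α : H →ₐ[k] k) (Λ : H) : nuL α ρ Λ = LinearMap.trace k V (ρ (LinearMap.mul' k H
    (comul (R := k) (contractLeft (α.toLinearMap ∘ₗ 𝒮) (comul (R := k) Λ))))) := by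
  unfold nuL
  generalize comul (R := k) Λ = t
  induction t with
  | zero => simp
  | add x y hx hy => simp only [map_add, hx, hy]
  | tmul x y => simp

theorem twistedDualAct_eq (α : H →ₐ[k] k) (h : H) (f : Module.Dual k V) :
    twistedDualAct α ρ h f = f ∘ₗ ρ (𝒮 (contractLeft α.toLinearMap (comul (R := k) h))) := by
  unfold twistedDualAct
  generalize comul (R := k) h = t
  induction t with
  | zero => simp
  | add x y hx hy => simp only [map_add, hx, hy, LinearMap.comp_add]
  | tmul x y => ext; simp [dualActAux]

/-- Invariance in adjoint form: `b(h v, w) = α(h₍₁₎) b(v, S(h₍₂₎) w)`. -/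
theorem isAlphaInvariantBil_iff_adjoint {α : H →ₐ[k] k} :
    IsAlphaInvariantBil α ρ b ↔ ∀ h v,
      b (ρ h v) = b v ∘ₗ ρ (𝒮 (contractLeft α.toLinearMap (comul (R := k) h))) := by
  rw [isAlphaInvariantBil_iff]
  constructor
  · intro hb h v
    have e := congrArg (fun f : WithConv (H →ₗ[k] H ⊗[k] H) => f h)
      (toConv_comul_mul_antipode (k := k) (H := H))
    have e2 : ∑ i ∈ (ℛ k h).index, comul (R := k) ((ℛ k h).left i) *
        ((1 : H) ⊗ₜ[k] 𝒮 ((ℛ k h).right i)) = h ⊗ₜ[k] (1 : H) :=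
      ((ℛ k h).convMul_apply (toConv (comul (R := k) (A := H)))
        (toConv (ι₂ ∘ₗ 𝒮))).symm.trans e
    ext w
    have e3 := LinearMap.congr_fun₂ (congrArg (actForm ρ b) e2) v w
    simp only [map_sum, actForm_mul, hb, actForm_smul] at e3
    rw [← (ℛ k h).eq]
    simp only [map_sum]
    simpa [LinearMap.sum_apply] using e3.symm
  · intro hb h
    ext v w
    have key (t : H ⊗[k] H) : actForm ρ b t v w =
        b v (ρ (LinearMap.mul' k H ((𝒮).rTensor H (TensorProduct.map
          (contractLeft α.toLinearMap ∘ₗ comul (R := k)) LinearMap.id t))) w) := by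
      induction t with
      | zero => simp
      | add x y hx hy => simp only [map_add, LinearMap.add_apply, hx, hy]
      | tmul x y => simp [hb]
    rw [key, ← comul_contractLeft_comul, mul_antipode_rTensor_comul_apply,
      counit_contractLeft_comul]
    simp

theorem mul_antipode_rTensor_comm_comul (hS : ∀ h : H, 𝒮 (𝒮 h) = h) (g : H) :
    LinearMap.mul' k H ((𝒮).rTensor H (TensorProduct.comm k H H (comul (R := k) g))) =
      algebraMap k H (counit g) := by
  have key (t : H ⊗[k] H) :
      LinearMap.mul' k H ((𝒮).rTensor H (TensorProduct.comm k H H t)) =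
        𝒮 (LinearMap.mul' k H ((𝒮).rTensor H t)) := by
    induction t with
    | zero => simp
    | add x y hx hy => simp only [map_add, hx, hy]
    | tmul x y => simp [antipode_mul_antidistrib, hS]
  rw [key, mul_antipode_rTensor_comul_apply, Algebra.algebraMap_eq_smul_one, map_smul,
    antipode_one]

/-- The flip of an invariant form is invariant. -/
theorem _root_.IsAlphaInvariantBil.flip {α : H →ₐ[k] k} (hS : ∀ h : H, 𝒮 (𝒮 h) = h)
    (hα : ∀ h : H, contractLeft α.toLinearMap (comul (R := k) h) =
      contractRight α.toLinearMap (comul (R := k) h))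
    (hb : IsAlphaInvariantBil α ρ b) : IsAlphaInvariantBil α ρ b.flip := by
  rw [isAlphaInvariantBil_iff_adjoint] at hb
  rw [isAlphaInvariantBil_iff]
  intro h
  ext v w
  have key (t : H ⊗[k] H) : actForm ρ b.flip t v w =
      b w (ρ (LinearMap.mul' k H ((𝒮).rTensor H (TensorProduct.comm k H H (TensorProduct.map
        LinearMap.id (contractRight α.toLinearMap ∘ₗ comul (R := k)) t)))) v) := by
    induction t with
    | zero => simp
    | add x y hx hy => simp only [map_add, LinearMap.add_apply, hx, hy]
    | tmul x y => simp [hb, hα]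
  rw [key, ← comul_contractRight_comul, mul_antipode_rTensor_comm_comul hS,
    counit_contractRight_comul]
  simp

theorem _root_.IsAlphaInvariantBil.sub_smul {α : H →ₐ[k] k} {b' : V →ₗ[k] V →ₗ[k] k}
    (hb : IsAlphaInvariantBil α ρ b) (hb' : IsAlphaInvariantBil α ρ b') (c : k) :
    IsAlphaInvariantBil α ρ (b' - c • b) := by
  rw [isAlphaInvariantBil_iff_adjoint] at *
  intro h v
  ext w
  simp [hb, hb']

/-- A nonzero invariant form on a simple module has trivial left radical. -/
theorem _root_.IsAlphaInvariantBil.ker_eq_bot {α : H →ₐ[k] k}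
    (hsimple : ∀ W : Submodule k V, (∀ (h : H), ∀ v ∈ W, ρ h v ∈ W) → W = ⊥ ∨ W = ⊤)
    (hb : IsAlphaInvariantBil α ρ b) (h0 : b ≠ 0) : LinearMap.ker b = ⊥ := by
  rw [isAlphaInvariantBil_iff_adjoint] at hb
  refine (hsimple (LinearMap.ker b) fun h v hv => ?_).resolve_right fun h => ?_
  · rw [LinearMap.mem_ker] at hv ⊢
    rw [hb, hv, LinearMap.zero_comp]
  · exact h0 (LinearMap.ker_eq_top.1 h)

theorem _root_.IsAlphaInvariantBil.isNondegBil {α : H →ₐ[k] k} (hS : ∀ h : H, 𝒮 (𝒮 h) = h)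
    (hα : ∀ h : H, contractLeft α.toLinearMap (comul (R := k) h) =
      contractRight α.toLinearMap (comul (R := k) h))
    (hsimple : ∀ W : Submodule k V, (∀ (h : H), ∀ v ∈ W, ρ h v ∈ W) → W = ⊥ ∨ W = ⊤)
    (hb : IsAlphaInvariantBil α ρ b) (h0 : b ≠ 0) : IsNondegBil b := by
  have h1 := hb.ker_eq_bot hsimple h0
  have h2 := (hb.flip hS hα).ker_eq_bot hsimple fun h => h0 (by rw [← b.flip_flip, h]; rfl)
  rw [LinearMap.ker_eq_bot'] at h1 h2
  exact ⟨fun v hv => h1 v (LinearMap.ext hv), fun w hw => h2 w (LinearMap.ext hw)⟩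

/-- Schur's lemma for invariant forms on a simple module. -/
theorem _root_.IsAlphaInvariantBil.exists_eq_smul [IsAlgClosed k] [FiniteDimensional k V] [Nontrivial V]
    {α : H →ₐ[k] k}
    (hsimple : ∀ W : Submodule k V, (∀ (h : H), ∀ v ∈ W, ρ h v ∈ W) → W = ⊥ ∨ W = ⊤)
    (hb : IsAlphaInvariantBil α ρ b) (h0 : b ≠ 0) {b' : V →ₗ[k] V →ₗ[k] k}
    (hb' : IsAlphaInvariantBil α ρ b') : ∃ c : k, b' = c • b := by
  let E : V ≃ₗ[k] Module.Dual k V := LinearEquiv.ofInjectiveOfFinrankEq b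
    (LinearMap.ker_eq_bot.1 (hb.ker_eq_bot hsimple h0)) Subspace.dual_finrank_eq.symm
  obtain ⟨c, hc⟩ := Module.End.exists_eigenvalue (E.symm.toLinearMap ∘ₗ b' : Module.End k V)
  obtain ⟨v, hv⟩ := hc.exists_hasEigenvector
  refine ⟨c, ?_⟩
  by_contra hne
  have hk := (hb.sub_smul hb' c).ker_eq_bot hsimple (sub_ne_zero.2 hne)
  refine hv.2 (LinearMap.ker_eq_bot'.1 hk v ?_)
  have h1 : E.symm (b' v) = c • v := hv.apply_eq_smul
  have h2 : b' v = c • b v := by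
    rw [LinearEquiv.symm_apply_eq, map_smul] at h1
    exact h1
  simp [h2]

/-- The element `e = α(S(Λ₍₁₎)) Λ₍₂₎` satisfies `e h = α(h) e`. -/
theorem contractLeft_antipode_mul {α : H →ₐ[k] k} {Λ : H} (hS : ∀ h : H, 𝒮 (𝒮 h) = h)
    (hΛ : ∀ h : H, Λ * h = counit (R := k) h • Λ) (h : H) :
    contractLeft (α.toLinearMap ∘ₗ 𝒮) (comul (R := k) Λ) * h =
      α h • contractLeft (α.toLinearMap ∘ₗ 𝒮) (comul (R := k) Λ) := by
  have key (t : H ⊗[k] H) : contractLeft (α.toLinearMap ∘ₗ 𝒮) (t * (𝒮 h ⊗ₜ[k] (1 : H))) =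
      α h • contractLeft (α.toLinearMap ∘ₗ 𝒮) t := by
    induction t with
    | zero => simp
    | add x y hx hy => simp only [add_mul, map_add, hx, hy, smul_add]
    | tmul x y => simp [antipode_mul_antidistrib, hS, mul_smul]
  have e := comul_mul_tmul_one hΛ (𝒮 h)
  rw [hS] at e
  rw [← contractLeft_mul_one_tmul, ← e, key]

theorem apply_contractLeft_antipode {α : H →ₐ[k] k} {Λ : H} (hΛ : counit (R := k) Λ = 1) :
    α (contractLeft (α.toLinearMap ∘ₗ 𝒮) (comul (R := k) Λ)) = 1 := by
  have key (t : H ⊗[k] H) : α (contractLeft (α.toLinearMap ∘ₗ 𝒮) t) =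
      α (LinearMap.mul' k H ((𝒮).rTensor H t)) := by
    induction t with
    | zero => simp
    | add x y hx hy => simp only [map_add, hx, hy]
    | tmul x y => simp
  rw [key, mul_antipode_rTensor_comul_apply, hΛ, map_one, map_one]

variable {α : H →ₐ[k] k} {e : H}

theorem isAlphaInvariantBil_actForm (he : ∀ h, e * h = α h • e) (b : V →ₗ[k] V →ₗ[k] k) :
    IsAlphaInvariantBil α ρ (actForm ρ b (comul (R := k) e)) := by
  rw [isAlphaInvariantBil_iff]
  intro h
  rw [← actForm_mul, ← Bialgebra.comul_mul, he, map_smul, map_smul]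

/-- The trace of `e₍₁₎ e₍₂₎` is the sign of an invariant form spanning all invariant forms. -/
theorem trace_comul_eq_of_flip [FiniteDimensional k V] (he : ∀ h, e * h = α h • e) (h1 : α e = 1)
    (hb : IsAlphaInvariantBil α ρ b) (h0 : b ≠ 0)
    (hspan : ∀ b', IsAlphaInvariantBil α ρ b' → ∃ c : k, b' = c • b) {s : k}
    (hs : b.flip = s • b) :
    LinearMap.trace k V (ρ (LinearMap.mul' k H (comul (R := k) e))) = s := by
  let B := Module.finBasis k V
  choose p hp using fun i j => hspan _
    (isAlphaInvariantBil_actForm (ρ := ρ) he ((B.coord i).smulRight (B.coord j)))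
  have hs' (v w : V) : b w v = s * b v w := LinearMap.congr_fun₂ hs v w
  have hP : actForm ρ b (comul (R := k) e) = b := by
    rw [isAlphaInvariantBil_iff.1 hb, h1, one_smul]
  let P : (V →ₗ[k] V →ₗ[k] k) →ₗ[k] V →ₗ[k] V →ₗ[k] k :=
    { toFun := fun b => actForm ρ b (comul (R := k) e)
      map_add' := fun _ _ => actForm_add _ _
      map_smul' := fun _ _ => actForm_smul _ _ }
  have h2 : (∑ i, ∑ j, b (B i) (B j) * p i j) • b = b := by
    conv_rhs => rw [← hP, ← sum_coord_smulRight_coord (b := b) B]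
    change _ = P _
    simp only [map_sum, map_smul, Finset.sum_smul, mul_smul]
    exact Finset.sum_congr rfl fun i _ => Finset.sum_congr rfl fun j _ => by rw [← hp]; rfl
  have h3 : ∑ i, ∑ j, b (B i) (B j) * p i j = 1 :=
    smul_left_injective k (M := V →ₗ[k] V →ₗ[k] k) h0 (h2.trans (one_smul k b).symm)
  rw [trace_mul' B]
  calc _ = ∑ i, ∑ j, s * (b (B i) (B j) * p i j) := by
        refine Finset.sum_congr rfl fun i _ => Finset.sum_congr rfl fun j _ => ?_
        rw [hp, LinearMap.smul_apply, LinearMap.smul_apply, hs' (B i) (B j), smul_eq_mul]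
        ring
    _ = s := by simp only [← Finset.mul_sum, h3, mul_one]

theorem trace_comul_eq_zero [FiniteDimensional k V] (he : ∀ h, e * h = α h • e)
    (h0 : ∀ b, IsAlphaInvariantBil α ρ b → b = 0) :
    LinearMap.trace k V (ρ (LinearMap.mul' k H (comul (R := k) e))) = 0 := by
  rw [trace_mul' (Module.finBasis k V)]
  simp [h0 _ (isAlphaInvariantBil_actForm he _)]

theorem exists_intertwiner_iff [FiniteDimensional k V] :
    (∃ φ : Module.Dual k V ≃ₗ[k] V,
      ∀ (h : H) (f : Module.Dual k V), φ (twistedDualAct α ρ h f) = ρ h (φ f)) ↔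
    ∃ b : V →ₗ[k] V →ₗ[k] k, IsAlphaInvariantBil α ρ b ∧ IsNondegBil b := by
  constructor
  · rintro ⟨φ, hφ⟩
    refine ⟨φ.symm.toLinearMap, isAlphaInvariantBil_iff_adjoint.2 fun h v => ?_,
      fun v hv => φ.symm.map_eq_zero_iff.1 (LinearMap.ext hv),
      fun w hw => (Module.forall_dual_apply_eq_zero_iff k w).1 fun f => ?_⟩
    · have := hφ h (φ.symm v)
      rw [twistedDualAct_eq, φ.apply_symm_apply] at this
      simp [← this]
    · simpa using hw (φ f)
  · rintro ⟨b, hb, hn, -⟩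
    rw [isAlphaInvariantBil_iff_adjoint] at hb
    let E : V ≃ₗ[k] Module.Dual k V := LinearEquiv.ofInjectiveOfFinrankEq b
      ((injective_iff_map_eq_zero b).2 fun v hv => hn v fun w => by simp [hv])
      Subspace.dual_finrank_eq.symm
    refine ⟨E.symm, fun h f => ?_⟩
    rw [LinearEquiv.symm_apply_eq, twistedDualAct_eq]
    have h1 : b (E.symm f) = f := E.apply_symm_apply f
    exact .trans (by rw [h1]) (hb h (E.symm f)).symm

end InvariantForms

end HopfAlgebra

/-- The twisted Frobenius–Schur theorem for a finite-dimensional semisimple Hopf algebra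
`H` over an algebraically closed field of characteristic `0`, twisted by a central
grouplike element `α` of the dual Hopf algebra: for a simple `H`-module `V`,
`ν(V; L) ∈ {0, ±1}`; `ν(V; L) ≠ 0` iff `V ≅ L ⊗ V^∨` iff there is a nondegenerate
bilinear form `b` with `b(h₍₁₎v, h₍₂₎w) = α(h)b(v, w)`; and such a `b` is unique up to
scalars and satisfies `b(w, v) = ν(V; L)·b(v, w)`. -/
theorem twisted_frobenius_schur_hopf
    [IsAlgClosed k] [CharZero k]
    [FiniteDimensional k H] [IsSemisimpleRing H]
    -- the Haar integral
    (Λ : H)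
    (hΛ_left : ∀ h : H, h * Λ = Coalgebra.counit (R := k) h • Λ)
    (hΛ_right : ∀ h : H, Λ * h = Coalgebra.counit (R := k) h • Λ)
    (hΛ_counit : Coalgebra.counit (R := k) Λ = 1)
    -- the algebra map α, a central grouplike element of the dual Hopf algebra
    (α : H →ₐ[k] k)
    (hα : ∀ h : H,
      TensorProduct.lid k H
          ((TensorProduct.map α.toLinearMap LinearMap.id) (Coalgebra.comul (R := k) h)) =
        TensorProduct.rid k H
          ((TensorProduct.map LinearMap.id α.toLinearMap) (Coalgebra.comul (R := k) h)))
    -- V is a simple finite-dimensional H-module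
    [FiniteDimensional k V] [Nontrivial V]
    (ρ : H →ₐ[k] Module.End k V)
    (hsimple : ∀ W : Submodule k V, (∀ (h : H), ∀ v ∈ W, ρ h v ∈ W) → W = ⊥ ∨ W = ⊤) :
    (nuL α ρ Λ = 0 ∨ nuL α ρ Λ = 1 ∨ nuL α ρ Λ = -1) ∧
    (nuL α ρ Λ ≠ 0 ↔
      ∃ φ : Module.Dual k V ≃ₗ[k] V,
        ∀ (h : H) (f : Module.Dual k V), φ (twistedDualAct α ρ h f) = ρ h (φ f)) ∧
    (nuL α ρ Λ ≠ 0 ↔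
      ∃ b : V →ₗ[k] V →ₗ[k] k, IsAlphaInvariantBil α ρ b ∧ IsNondegBil b) ∧
    (∀ b : V →ₗ[k] V →ₗ[k] k, IsAlphaInvariantBil α ρ b → IsNondegBil b →
      ((∀ v w : V, b w v = nuL α ρ Λ * b v w) ∧
        (∀ b' : V →ₗ[k] V →ₗ[k] k, IsAlphaInvariantBil α ρ b' → IsNondegBil b' →
          ∃ c : k, b' = c • b))) := by
  have hΛ : HopfAlgebra.IsHaarIntegral k Λ := ⟨hΛ_left, hΛ_right, hΛ_counit⟩
  have hS := hΛ.antipode_antipode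
  have he := HopfAlgebra.contractLeft_antipode_mul (α := α) hS hΛ_right
  have h1 := HopfAlgebra.apply_contractLeft_antipode (α := α) hΛ_counit
  rw [HopfAlgebra.exists_intertwiner_iff, HopfAlgebra.nuL_eq]
  set e := HopfAlgebra.contractLeft (α.toLinearMap ∘ₗ HopfAlgebra.antipode k)
    (Coalgebra.comul (R := k) Λ)
  set ν := LinearMap.trace k V (ρ (LinearMap.mul' k H (Coalgebra.comul (R := k) e)))
  have hsign (b : V →ₗ[k] V →ₗ[k] k) (hb : IsAlphaInvariantBil α ρ b) (h0 : b ≠ 0) :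
      b.flip = ν • b ∧ (ν = 1 ∨ ν = -1) := by
    have hspan b' (hb' : IsAlphaInvariantBil α ρ b') := hb.exists_eq_smul hsimple h0 hb'
    obtain ⟨s, hs⟩ := hspan _ (hb.flip hS hα)
    have hν : ν = s := HopfAlgebra.trace_comul_eq_of_flip he h1 hb h0 hspan hs
    refine ⟨hν ▸ hs, ?_⟩
    rw [hν, ← sq_eq_one_iff]
    refine smul_left_injective k (M := V →ₗ[k] V →ₗ[k] k) h0 ?_
    change s ^ 2 • b = (1 : k) • b
    ext v w
    have h2 := LinearMap.congr_fun₂ hs v w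
    have h3 := LinearMap.congr_fun₂ hs w v
    simp only [LinearMap.flip_apply, LinearMap.smul_apply, smul_eq_mul] at h2 h3 ⊢
    rw [pow_two, mul_assoc, ← h2, ← h3, one_mul]
  have hnondeg (b : V →ₗ[k] V →ₗ[k] k) (hb : IsNondegBil b) : b ≠ 0 := by
    rintro rfl
    obtain ⟨v, hv⟩ := exists_ne (0 : V)
    exact hv (hb.1 v fun _ => rfl)
  have hiff : ν ≠ 0 ↔ ∃ b : V →ₗ[k] V →ₗ[k] k, IsAlphaInvariantBil α ρ b ∧ IsNondegBil b := by
    constructor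
    · intro hν
      by_contra! hcon
      refine hν (HopfAlgebra.trace_comul_eq_zero he fun b hb => ?_)
      by_contra h0
      exact hcon b hb (hb.isNondegBil hS hα hsimple h0)
    · rintro ⟨b, hb, hn⟩
      rcases (hsign b hb (hnondeg b hn)).2 with h | h <;> simp [h]
  refine ⟨?_, hiff, hiff, fun b hb hn => ⟨fun v w => ?_, fun b' hb' _ => ?_⟩⟩
  · by_cases hν : ν = 0
    · exact Or.inl hν
    · obtain ⟨b, hb, hn⟩ := hiff.1 hν
      exact Or.inr (hsign b hb (hnondeg b hn)).2
  · exact LinearMap.congr_fun₂ (hsign b hb (hnondeg b hn)).1 v w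
  · exact hb.exists_eq_smul hsimple (hnondeg b hn) hb'
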